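/- arXiv:1603.03415 — 5 statements merged into one kernel-verified Lean document; each statement's English description precedes it below -/
import Mathlib

section
/- Let μ be a uniformly distributed measure on ℝ^d and let f : [0,∞) → [0,∞] be a Borel function. Then for all z, y in the support of μ, ∫_{ℝ^d} f(|x−z|) dμ(x) = ∫_{ℝ^d} f(|x−y|) dμ(x). -/
open MeasureTheory Metric Filter Set

noncomputable section

abbrev Euc (d : ℕ) : Type := EuclideanSpace ℝ (Fin d)

/-- The support of a measure: points all of whose closed balls have positive measure. -/
def msupport {d : ℕ} (μ : Measure (Euc d)) : Set (Euc d) :=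
  {x | ∀ r : ℝ, 0 < r → 0 < μ (Metric.closedBall x r)}

/-- `φ` is a distribution function of the uniformly distributed measure `μ`. -/
def IsDistributionFunction {d : ℕ} (μ : Measure (Euc d)) (φ : ℝ → ENNReal) : Prop :=
  (msupport μ).Nonempty ∧
  (∀ r : ℝ, 0 < r → 0 < φ r ∧ φ r < ⊤) ∧
  (∀ x ∈ msupport μ, ∀ r : ℝ, 0 < r → μ (Metric.closedBall x r) = φ r)

/-- `μ` is uniformly distributed. -/
def UniformlyDistributed {d : ℕ} (μ : Measure (Euc d)) : Prop :=
  ∃ φ : ℝ → ENNReal, IsDistributionFunction μ φ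

/-- `dim₀ μ = n` : the limit of `φ(r)/rⁿ` as `r → 0⁺` exists, is finite and positive. -/
def HasDim0 (φ : ℝ → ENNReal) (n : ℕ) : Prop :=
  ∃ c : ℝ, 0 < c ∧
    Filter.Tendsto (fun r : ℝ => (φ r).toReal / r ^ n) (nhdsWithin 0 (Set.Ioi 0)) (nhds c)

/-- `dim_∞ μ = p` : the limit of `φ(r)/r^p` as `r → ∞` exists, is finite and positive. -/
def HasDimInfty (φ : ℝ → ENNReal) (p : ℕ) : Prop :=
  ∃ c : ℝ, 0 < c ∧
    Filter.Tendsto (fun r : ℝ => (φ r).toReal / r ^ p) Filter.atTop (nhds c)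

/-- The affine `n`-planes of `ℝ^d`. -/
def nPlanes (d n : ℕ) : Set (AffineSubspace ℝ (Euc d)) :=
  {L | (L : Set (Euc d)).Nonempty ∧ Module.finrank ℝ L.direction = n}

/-- Jones' beta number `β^n_μ(B(x,r))`. -/
def jonesBeta {d : ℕ} (n : ℕ) (μ : Measure (Euc d)) (x : Euc d) (r : ℝ) : ℝ :=
  ⨅ L : nPlanes d n,
    ⨆ y : (msupport μ ∩ Metric.closedBall x r : Set (Euc d)),
      Metric.infDist y.1 (L.1 : Set (Euc d)) / r

/-- The bilateral beta number `bβ^n_μ(B(x,r))`. -/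
def bilateralBeta {d : ℕ} (n : ℕ) (μ : Measure (Euc d)) (x : Euc d) (r : ℝ) : ℝ :=
  ⨅ L : nPlanes d n,
    ((⨆ y : (msupport μ ∩ Metric.closedBall x r : Set (Euc d)),
        Metric.infDist y.1 (L.1 : Set (Euc d)) / r) +
     (⨆ p : ((L.1 : Set (Euc d)) ∩ Metric.closedBall x r : Set (Euc d)),
        Metric.infDist p.1 (msupport μ) / r))

/-- `μ` is doubling with constant `C`. -/
def DoublingWith {d : ℕ} (μ : Measure (Euc d)) (C : ℝ) : Prop :=
  ∀ x ∈ msupport μ, ∀ r : ℝ, 0 < r →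
    μ (Metric.closedBall x (2 * r)) ≤ ENNReal.ofReal C * μ (Metric.closedBall x r)

/-- `μ` is doubling. -/
def Doubling {d : ℕ} (μ : Measure (Euc d)) : Prop :=
  ∃ C : ℝ, 0 < C ∧ DoublingWith μ C

/-- Weak convergence of a sequence of Radon measures. -/
def WeakConv {d : ℕ} (μs : ℕ → Measure (Euc d)) (μ : Measure (Euc d)) : Prop :=
  ∀ f : Euc d → ℝ, Continuous f → HasCompactSupport f →
    Filter.Tendsto (fun j => ∫ x, f x ∂(μs j)) Filter.atTop (nhds (∫ x, f x ∂μ))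

/-- `μ` is `n`-asymptotically optimally doubling. -/
def AsympOptDoubling {d : ℕ} (n : ℕ) (μ : Measure (Euc d)) : Prop :=
  ∀ K : Set (Euc d), IsCompact K → K ⊆ msupport μ →
    ∀ t : ℝ, t ∈ Set.Icc (1/2 : ℝ) 1 →
      Filter.Tendsto
        (fun r : ℝ => ⨆ x : K,
          |(μ (Metric.closedBall x.1 (t * r)) / μ (Metric.closedBall x.1 r)).toReal - t ^ n|)
        (nhdsWithin 0 (Set.Ioi 0)) (nhds 0)

/-- Truncated `n`-Riesz transform `R_{r,s}μ(z)`. -/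
def rieszT {d : ℕ} (n : ℕ) (μ : Measure (Euc d)) (z : Euc d) (r s : ℝ) : Euc d :=
  ∫ y in {y : Euc d | r ≤ dist y z ∧ dist y z ≤ s}, (‖y - z‖ ^ (n + 1))⁻¹ • (y - z) ∂μ

/-- `μ` is locally Ahlfors `n`-regular. -/
def LocallyAhlforsRegular {d : ℕ} (n : ℕ) (μ : Measure (Euc d)) : Prop :=
  ∀ K : Set (Euc d), IsCompact K → ∃ c : ℝ, 0 < c ∧ ∃ rK : ℝ, 0 < rK ∧
    ∀ x ∈ msupport μ ∩ K, ∀ r : ℝ, 0 < r → r ≤ rK →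
      ENNReal.ofReal (c⁻¹ * r ^ n) ≤ μ (Metric.closedBall x r) ∧
      μ (Metric.closedBall x r) ≤ ENNReal.ofReal (c * r ^ n)

/-- `μ` is locally uniformly `n`-rectifiable. -/
def LocUnifRectifiable {d : ℕ} (n : ℕ) (μ : Measure (Euc d)) : Prop :=
  LocallyAhlforsRegular n μ ∧
  ∀ K : Set (Euc d), IsCompact K →
    ∃ RK θK MK : ℝ, 0 < RK ∧ 0 < θK ∧ 0 < MK ∧
      ∀ x ∈ msupport μ ∩ K, ∀ R : ℝ, 0 < R → R ≤ RK →
        ∃ g : EuclideanSpace ℝ (Fin n) → Euc d,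
          LipschitzWith (Real.toNNReal MK) g ∧
          ENNReal.ofReal (θK * R ^ n) ≤ μ (Metric.closedBall x R ∩ Set.range g)

/-- Two points all of whose closed balls of positive radius have the same finite measure also
carry the same mass on closed balls of arbitrary radius. -/
theorem measure_closedBall_eq_of_pos {X : Type*} [PseudoMetricSpace X] [MeasurableSpace X]
    [OpensMeasurableSpace X] {μ : Measure X} {z y : X}
    (h : ∀ r : ℝ, 0 < r → μ (closedBall z r) = μ (closedBall y r))
    (hfin : ∀ r : ℝ, 0 < r → μ (closedBall z r) < ⊤) (r : ℝ) :
    μ (closedBall z r) = μ (closedBall y r) := by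
  rcases lt_trichotomy r 0 with hr | rfl | hr
  · simp [closedBall_eq_empty.2 hr]
  · have key : ∀ w : X, (∀ r : ℝ, 0 < r → μ (closedBall w r) < ⊤) →
        Tendsto (fun r : ℝ => μ (closedBall w r)) (nhdsWithin 0 (Ioi 0))
          (nhds (μ (closedBall w 0))) := by
      intro w hw
      have hInter : closedBall w 0 = ⋂ r : ℝ, ⋂ _ : r > 0, closedBall w r := by
        ext x
        simp only [mem_iInter, mem_closedBall]
        exact ⟨fun hx r hr => hx.trans hr.le, fun hx => le_of_forall_gt_imp_ge_of_dense hx⟩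
      rw [hInter]
      exact tendsto_measure_biInter_gt
        (fun r _ => isClosed_closedBall.measurableSet.nullMeasurableSet)
        (fun i j _ hij => closedBall_subset_closedBall hij) ⟨1, one_pos, (hw 1 one_pos).ne⟩
    refine tendsto_nhds_unique (key z hfin)
      ((key y fun r hr => h r hr ▸ hfin r hr).congr' ?_)
    filter_upwards [self_mem_nhdsWithin] with r hr
    exact (h r hr).symm
  · exact h r hr

/-- The distance functions to two points whose closed balls have equal finite measure have the
same distribution. -/
theorem map_dist_eq_of_measure_closedBall_eq {X : Type*} [PseudoMetricSpace X]
    [MeasurableSpace X] [OpensMeasurableSpace X] {μ : Measure X} {z y : X}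
    (h : ∀ r : ℝ, 0 < r → μ (closedBall z r) = μ (closedBall y r))
    (hfin : ∀ r : ℝ, 0 < r → μ (closedBall z r) < ⊤) :
    μ.map (fun x => dist x z) = μ.map (fun x => dist x y) := by
  have map_Iic : ∀ (w : X) (a : ℝ),
      μ.map (fun x => dist x w) (Iic a) = μ (closedBall w a) := fun w a =>
    Measure.map_apply (continuous_id.dist continuous_const).measurable measurableSet_Iic
  refine Measure.ext_of_generateFrom_of_iUnion (range Iic) (fun n : ℕ => Iic ((n : ℝ) + 1))
    (BorelSpace.measurable_eq.trans (borel_eq_generateFrom_Iic ℝ)) isPiSystem_Iic ?_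
    (fun n => mem_range_self _) (fun n => ?_) ?_
  · refine eq_univ_of_forall fun x => mem_iUnion.2 ?_
    obtain ⟨n, hn⟩ := exists_nat_ge x
    exact ⟨n, hn.trans (by simp)⟩
  · rw [map_Iic]
    exact (hfin _ (by positivity)).ne
  · rintro _ ⟨a, rfl⟩
    rw [map_Iic, map_Iic]
    exact measure_closedBall_eq_of_pos h hfin a

theorem radial_integrals_equal {d : ℕ}
    (μ : Measure (Euc d)) [IsLocallyFiniteMeasure μ]
    (hμ : UniformlyDistributed μ)
    (f : ℝ → ENNReal) (hf : Measurable f)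
    (z y : Euc d) (hz : z ∈ msupport μ) (hy : y ∈ msupport μ) :
    ∫⁻ x, f (dist x z) ∂μ = ∫⁻ x, f (dist x y) ∂μ := by
  obtain ⟨φ, -, hφ, hball⟩ := hμ
  have hmap := map_dist_eq_of_measure_closedBall_eq (μ := μ) (z := z) (y := y)
    (fun r hr => (hball z hz r hr).trans (hball y hy r hr).symm)
    (fun r hr => (hball z hz r hr).trans_lt (hφ r hr).2)
  have hlint : ∀ w : Euc d, ∫⁻ t, f t ∂μ.map (fun x => dist x w) = ∫⁻ x, f (dist x w) ∂μ :=
    fun w => lintegral_map hf (continuous_id.dist continuous_const).measurable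
  rw [← hlint, ← hlint, hmap]
end
end

section
/- Let μ_j (j ∈ ℕ) and μ be Radon measures on ℝ^d, all doubling with the same constant C > 0, with supports Σ_j and Σ respectively. Let B̄ be a closed ball in ℝ^d such that B̄ ∩ Σ ≠ ∅ and B̄ ∩ Σ_j ≠ ∅ for all j. If μ_j ⇀ μ, then sup_{x ∈ Σ_j ∩ B̄} dist(x, Σ ∩ 2B̄) + sup_{x ∈ Σ ∩ B̄} dist(x, Σ_j ∩ 2B̄) → 0 as j → ∞ (here 2B̄ is the concentric closed ball of twice the radius). -/
open MeasureTheory Metric Filter Set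

noncomputable section

/-- A set of positive measure contains a point of the support. -/
theorem exists_mem_msupport_of_measure_ne_zero {d : ℕ} {μ : Measure (Euc d)} {s : Set (Euc d)}
    (hs : μ s ≠ 0) : ∃ x ∈ s, x ∈ msupport μ := by
  obtain ⟨x, hxs, hx⟩ := exists_mem_forall_mem_nhdsWithin_pos_measure hs
  exact ⟨x, hxs, fun r hr => hx _ (mem_nhdsWithin_of_mem_nhds (closedBall_mem_nhds x hr))⟩

theorem DoublingWith.measure_closedBall_two_pow_mul_le {d : ℕ} {μ : Measure (Euc d)} {C : ℝ}
    (h : DoublingWith μ C) {x : Euc d} (hx : x ∈ msupport μ) {r : ℝ} (hr : 0 < r) (k : ℕ) :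
    μ (closedBall x (2 ^ k * r)) ≤ ENNReal.ofReal C ^ k * μ (closedBall x r) := by
  induction k with
  | zero => simp
  | succ k ih =>
    calc μ (closedBall x (2 ^ (k + 1) * r))
        = μ (closedBall x (2 * (2 ^ k * r))) := by rw [pow_succ']; ring_nf
      _ ≤ ENNReal.ofReal C * μ (closedBall x (2 ^ k * r)) := h x hx _ (by positivity)
      _ ≤ ENNReal.ofReal C * (ENNReal.ofReal C ^ k * μ (closedBall x r)) := by gcongr
      _ = ENNReal.ofReal C ^ (k + 1) * μ (closedBall x r) := by rw [pow_succ', mul_assoc]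

section Bump

variable {d : ℕ} (μ : Measure (Euc d)) [IsLocallyFiniteMeasure μ] {c : Euc d}
  (f : ContDiffBump c)

theorem ContDiffBump.measureReal_closedBall_rIn_le_integral :
    μ.real (closedBall c f.rIn) ≤ ∫ x, f x ∂μ := by
  rw [← integral_indicator_one measurableSet_closedBall]
  refine integral_mono_of_nonneg (.of_forall fun x => indicator_nonneg (by simp) x)
    (f.continuous.integrable_of_hasCompactSupport f.hasCompactSupport) (.of_forall fun x => ?_)
  by_cases hx : x ∈ closedBall c f.rIn
  · simp [hx, f.one_of_mem_closedBall hx]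
  · simp [hx, f.nonneg]

theorem ContDiffBump.integral_le_measureReal_closedBall_rOut :
    ∫ x, f x ∂μ ≤ μ.real (closedBall c f.rOut) := by
  rw [← integral_indicator_one measurableSet_closedBall]
  refine integral_mono_of_nonneg (.of_forall fun x => f.nonneg)
    ((integrable_indicator_iff measurableSet_closedBall).2
      (integrableOn_const (measure_closedBall_lt_top).ne)) (.of_forall fun x => ?_)
  by_cases hx : x ∈ closedBall c f.rOut
  · simp [hx, f.le_one]
  · simp [hx, f.zero_of_le_dist (not_le.1 hx).le]

end Bump

theorem IsCompact.eventually_forall_of_locally {X ι : Type*} [TopologicalSpace X] {K : Set X}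
    (hK : IsCompact K) {l : Filter ι} {P : ι → X → Prop}
    (h : ∀ x ∈ K, ∃ U ∈ nhds x, ∀ᶠ j in l, ∀ y ∈ U, P j y) :
    ∀ᶠ j in l, ∀ y ∈ K, P j y := by
  refine hK.induction_on (p := fun s => ∀ᶠ j in l, ∀ y ∈ s, P j y) (by simp)
    (fun s t hst ht => ht.mono fun j hj y hy => hj y (hst hy))
    (fun s t hs ht => ?_) fun x hx => ?_
  · filter_upwards [hs, ht] with j hsj htj y hy
    exact hy.elim (hsj y) (htj y)
  · obtain ⟨U, hU, hj⟩ := h x hx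
    exact ⟨U, mem_nhdsWithin_of_mem_nhds hU, hj⟩

theorem integral_bump_pos_of_mem_msupport {d : ℕ} {μ : Measure (Euc d)}
    [IsLocallyFiniteMeasure μ] {c : Euc d} (f : ContDiffBump c) {y : Euc d} (hy : y ∈ msupport μ)
    {r : ℝ} (hr : 0 < r) (hyr : r + dist y c ≤ f.rIn) : 0 < ∫ x, f x ∂μ := by
  refine lt_of_lt_of_le ?_ (f.measureReal_closedBall_rIn_le_integral μ)
  refine ENNReal.toReal_pos ?_ measure_closedBall_lt_top.ne
  exact ((hy r hr).trans_le (measure_mono (closedBall_subset_closedBall' hyr))).ne'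

theorem integral_bump_eq_zero_of_disjoint_msupport {d : ℕ} {μ : Measure (Euc d)}
    [IsLocallyFiniteMeasure μ] {c : Euc d} (f : ContDiffBump c)
    (hf : ∀ z ∈ closedBall c f.rOut, z ∉ msupport μ) : ∫ x, f x ∂μ = 0 := by
  refine le_antisymm ((f.integral_le_measureReal_closedBall_rOut μ).trans_eq ?_)
    (integral_nonneg fun x => f.nonneg)
  by_contra h
  obtain ⟨z, hz, hzμ⟩ := exists_mem_msupport_of_measure_ne_zero
    (μ := μ) (s := closedBall c f.rOut) (fun h0 => h (by simp [Measure.real, h0]))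
  exact hf z hz hzμ

/-- Points of the limiting support are uniformly approximated, on compact sets, by points of the
supports of a weakly convergent sequence. -/
theorem WeakConv.eventually_exists_mem_msupport_seq {d : ℕ} {μs : ℕ → Measure (Euc d)}
    {μ : Measure (Euc d)} [IsLocallyFiniteMeasure μ] (hls : ∀ j, IsLocallyFiniteMeasure (μs j))
    (hconv : WeakConv μs μ) {K : Set (Euc d)} (hK : IsCompact K) {ε : ℝ} (hε : 0 < ε) :
    ∀ᶠ j in atTop, ∀ y ∈ K, y ∈ msupport μ → ∃ z ∈ msupport (μs j), dist y z ≤ ε := by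
  refine hK.eventually_forall_of_locally fun x _ =>
    ⟨closedBall x (ε / 4), closedBall_mem_nhds x (by positivity), ?_⟩
  by_cases hx : ∃ y ∈ closedBall x (ε / 4), y ∈ msupport μ
  · obtain ⟨y, hyx, hy⟩ := hx
    let f : ContDiffBump x := ⟨ε / 2, 3 * ε / 4, by positivity, by linarith⟩
    have hpos : 0 < ∫ x, f x ∂μ :=
      integral_bump_pos_of_mem_msupport f hy (r := ε / 4) (by positivity)
        (by change _ ≤ ε / 2; linarith [mem_closedBall.1 hyx])
    filter_upwards [(hconv f f.continuous f.hasCompactSupport).eventually_const_lt hpos]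
      with j hj y hy _
    by_contra! h
    refine hj.ne' (integral_bump_eq_zero_of_disjoint_msupport f fun z hz hzj => ?_)
    have hz' : dist z x ≤ 3 * ε / 4 := hz
    linarith [h z hzj, dist_triangle_right y z x, mem_closedBall.1 hy]
  · exact .of_forall fun j y hy hyμ => (hx ⟨y, hy, hyμ⟩).elim

/-- Points of the supports of a weakly convergent sequence of uniformly doubling measures are
uniformly approximated, on compact sets, by points of the limiting support. -/
theorem WeakConv.eventually_exists_mem_msupport_limit {d : ℕ} {μs : ℕ → Measure (Euc d)}
    {μ : Measure (Euc d)} [IsLocallyFiniteMeasure μ] (hls : ∀ j, IsLocallyFiniteMeasure (μs j))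
    (hconv : WeakConv μs μ) {C : ℝ} (hC : 0 ≤ C) (hdoub : ∀ j, DoublingWith (μs j) C)
    (hμ : (msupport μ).Nonempty) {K : Set (Euc d)} (hK : IsCompact K) {ε : ℝ} (hε : 0 < ε) :
    ∀ᶠ j in atTop, ∀ y ∈ K, y ∈ msupport (μs j) → ∃ z ∈ msupport μ, dist y z ≤ ε := by
  obtain ⟨w, hw⟩ := hμ
  refine hK.eventually_forall_of_locally fun x _ =>
    ⟨closedBall x (ε / 4), closedBall_mem_nhds x (by positivity), ?_⟩
  by_cases hx : ∃ z ∈ closedBall x (3 * ε / 4), z ∈ msupport μ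
  · obtain ⟨z, hzx, hz⟩ := hx
    refine .of_forall fun j y hy _ => ⟨z, hz, ?_⟩
    linarith [dist_triangle_right y z x, mem_closedBall.1 hy, mem_closedBall.1 hzx]
  · push Not at hx
    let f : ContDiffBump x := ⟨ε / 2, 3 * ε / 4, by positivity, by linarith⟩
    let g : ContDiffBump w := ⟨1, 2, one_pos, one_lt_two⟩
    obtain ⟨k, hk⟩ : ∃ k : ℕ, (2 + dist w x + ε / 4) / (ε / 4) < 2 ^ k :=
      pow_unbounded_of_one_lt _ one_lt_two
    rw [div_lt_iff₀ (by positivity)] at hk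
    have hf0 : ∫ x, f x ∂μ = 0 := integral_bump_eq_zero_of_disjoint_msupport f hx
    have hg : 0 < ∫ x, g x ∂μ :=
      integral_bump_pos_of_mem_msupport g hw one_pos (by simp [g])
    have hlim := (hconv f f.continuous f.hasCompactSupport).const_mul (C ^ k)
    rw [hf0, mul_zero] at hlim
    filter_upwards [hlim.eventually_lt (hconv g g.continuous g.hasCompactSupport) hg]
      with j hj y hy hyj
    refine absurd hj (not_lt.2 ?_)
    have hyx : dist y x ≤ ε / 4 := hy
    calc ∫ x, g x ∂(μs j)
        ≤ (μs j).real (closedBall w 2) := g.integral_le_measureReal_closedBall_rOut _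
      _ ≤ (μs j).real (closedBall y (2 ^ k * (ε / 4))) := by
          refine measureReal_mono (closedBall_subset_closedBall' ?_) measure_closedBall_lt_top.ne
          linarith [dist_triangle_right w y x]
      _ ≤ C ^ k * (μs j).real (closedBall y (ε / 4)) := by
          have h := ENNReal.toReal_mono
            (ENNReal.mul_ne_top (by simp) measure_closedBall_lt_top.ne)
            ((hdoub j).measure_closedBall_two_pow_mul_le hyj (r := ε / 4) (by positivity) k)
          simpa [Measure.real, ENNReal.toReal_ofReal hC] using h
      _ ≤ C ^ k * (μs j).real (closedBall x (ε / 2)) := by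
          gcongr
          · exact measure_closedBall_lt_top.ne
          · exact closedBall_subset_closedBall' (by linarith)
      _ ≤ C ^ k * ∫ x, f x ∂(μs j) := by
          gcongr
          exact f.measureReal_closedBall_rIn_le_integral _

theorem infDist_inter_closedBall_le {X : Type*} [PseudoMetricSpace X] {S : Set X} {x₀ y : X}
    {r ε : ℝ} (hy : y ∈ closedBall x₀ r) (hε : ε ≤ r) (h : ∃ z ∈ S, dist y z ≤ ε) :
    infDist y (S ∩ closedBall x₀ (2 * r)) ≤ ε := by
  obtain ⟨z, hz, hyz⟩ := h
  have hzr : z ∈ closedBall x₀ (2 * r) := by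
    rw [mem_closedBall] at hy ⊢
    linarith [dist_triangle_left z x₀ y]
  exact (infDist_le_dist_of_mem (mem_inter hz hzr)).trans hyz

theorem supports_converge_of_weakConv {d : ℕ}
    (μs : ℕ → Measure (Euc d)) (μ : Measure (Euc d))
    [IsLocallyFiniteMeasure μ] (hls : ∀ j, IsLocallyFiniteMeasure (μs j))
    (C : ℝ) (hC : 0 < C)
    (hdoub : ∀ j, DoublingWith (μs j) C) (hdoubμ : DoublingWith μ C)
    (x₀ : Euc d) (r₀ : ℝ) (hr₀ : 0 < r₀)
    (hS : (msupport μ ∩ Metric.closedBall x₀ r₀).Nonempty)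
    (hSj : ∀ j, (msupport (μs j) ∩ Metric.closedBall x₀ r₀).Nonempty)
    (hconv : WeakConv μs μ) :
    Filter.Tendsto
      (fun j =>
        (⨆ x : (msupport (μs j) ∩ Metric.closedBall x₀ r₀ : Set (Euc d)),
          Metric.infDist x.1 (msupport μ ∩ Metric.closedBall x₀ (2 * r₀))) +
        (⨆ x : (msupport μ ∩ Metric.closedBall x₀ r₀ : Set (Euc d)),
          Metric.infDist x.1 (msupport (μs j) ∩ Metric.closedBall x₀ (2 * r₀))))
      Filter.atTop (nhds 0) := by
  obtain ⟨w, hw, -⟩ := hS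
  refine Metric.tendsto_nhds.2 fun ε hε => ?_
  have hδ : 0 < min (ε / 3) r₀ := by positivity
  have hK := isCompact_closedBall x₀ r₀
  filter_upwards [hconv.eventually_exists_mem_msupport_seq hls hK hδ,
    hconv.eventually_exists_mem_msupport_limit hls hC.le hdoub ⟨w, hw⟩ hK hδ] with j h₁ h₂
  rw [Real.dist_0_eq_abs, abs_of_nonneg (add_nonneg (Real.iSup_nonneg fun _ => infDist_nonneg)
    (Real.iSup_nonneg fun _ => infDist_nonneg))]
  have hle : min (ε / 3) r₀ ≤ ε / 3 := min_le_left _ _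
  refine (add_le_add (Real.iSup_le (a := ε / 3) (fun y => ?_) (by positivity))
    (Real.iSup_le (a := ε / 3) (fun y => ?_) (by positivity))).trans_lt (by linarith)
  · exact (infDist_inter_closedBall_le y.2.2 (min_le_right _ _) (h₂ y y.2.2 y.2.1)).trans hle
  · exact (infDist_inter_closedBall_le y.2.2 (min_le_right _ _) (h₁ y y.2.2 y.2.1)).trans hle
end
end

section
/- Let μ_j (j ∈ ℕ) and μ be Radon measures on ℝ^d, all doubling with the same constant C > 0, with supports Σ_j and Σ, let B be a ball with Σ ∩ B ≠ ∅ and Σ_j ∩ B ≠ ∅ for all j, and let n be an integer with 0 < n ≤ d. If μ_j ⇀ μ, then (1/2)·limsup_{j→∞} bβ^n_{μ_j}((1/2)B) ≤ bβ^n_μ(B) ≤ 2·liminf_{j→∞} bβ^n_{μ_j}(2B), where (1/2)B and 2B denote the concentric balls of half and twice the radius of B. -/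
open MeasureTheory Metric Filter Set

noncomputable section

lemma msupport_eq_support {d : ℕ} (μ : Measure (Euc d)) : msupport μ = μ.support := by
  ext x
  exact (Metric.nhds_basis_closedBall.mem_measureSupport).symm

lemma exists_mem_msupport_of_pos {d : ℕ} {μ : Measure (Euc d)} {s : Set (Euc d)}
    (h : 0 < μ.real s) : ∃ y ∈ msupport μ, y ∈ s := by
  obtain ⟨y, hys, hy⟩ :=
    Measure.nonempty_inter_support_of_pos (ENNReal.toReal_pos_iff.1 h).1
  exact ⟨y, msupport_eq_support μ ▸ hy, hys⟩

lemma real_closedBall_pos {d : ℕ} {μ : Measure (Euc d)} [IsLocallyFiniteMeasure μ] {x : Euc d}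
    (hx : x ∈ msupport μ) {r : ℝ} (hr : 0 < r) : 0 < μ.real (closedBall x r) :=
  ENNReal.toReal_pos (hx r hr).ne' measure_closedBall_lt_top.ne

lemma DoublingWith.real_closedBall_two_pow_le {d : ℕ} {μ : Measure (Euc d)}
    [IsLocallyFiniteMeasure μ] {C : ℝ} (hC : 0 ≤ C) (h : DoublingWith μ C) {x : Euc d}
    (hx : x ∈ msupport μ) {r : ℝ} (hr : 0 < r) (k : ℕ) :
    μ.real (closedBall x (2 ^ k * r)) ≤ C ^ k * μ.real (closedBall x r) := by
  induction k with
  | zero => simp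
  | succ k ih =>
    have hk := ENNReal.toReal_mono
      (ENNReal.mul_ne_top ENNReal.ofReal_ne_top measure_closedBall_lt_top.ne)
      (h x hx (2 ^ k * r) (by positivity))
    rw [ENNReal.toReal_mul, ENNReal.toReal_ofReal hC] at hk
    calc μ.real (closedBall x (2 ^ (k + 1) * r))
        = μ.real (closedBall x (2 * (2 ^ k * r))) := by ring_nf
      _ ≤ C * μ.real (closedBall x (2 ^ k * r)) := hk
      _ ≤ C * (C ^ k * μ.real (closedBall x r)) := by gcongr
      _ = C ^ (k + 1) * μ.real (closedBall x r) := by ring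

/-- A continuous function equal to one on `closedBall x r` and to zero off `closedBall x (2 * r)`. -/
def ballCutoff {d : ℕ} (x : Euc d) (r : ℝ) (y : Euc d) : ℝ :=
  max 0 (min 1 (2 - dist y x / r))

lemma continuous_ballCutoff {d : ℕ} (x : Euc d) (r : ℝ) : Continuous (ballCutoff x r) := by
  unfold ballCutoff
  fun_prop

lemma ballCutoff_eq_zero {d : ℕ} {x y : Euc d} {r : ℝ} (hr : 0 < r)
    (hy : y ∉ closedBall x (2 * r)) : ballCutoff x r y = 0 := by
  rw [mem_closedBall, not_le] at hy
  have : 2 ≤ dist y x / r := by rw [le_div_iff₀ hr]; exact hy.le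
  exact max_eq_left ((min_le_right _ _).trans (by linarith))

lemma hasCompactSupport_ballCutoff {d : ℕ} (x : Euc d) {r : ℝ} (hr : 0 < r) :
    HasCompactSupport (ballCutoff x r) :=
  HasCompactSupport.intro (isCompact_closedBall x (2 * r)) fun _ => ballCutoff_eq_zero hr

lemma integrable_ballCutoff {d : ℕ} (μ : Measure (Euc d)) [IsLocallyFiniteMeasure μ]
    (x : Euc d) {r : ℝ} (hr : 0 < r) : Integrable (ballCutoff x r) μ :=
  (continuous_ballCutoff x r).integrable_of_hasCompactSupport (hasCompactSupport_ballCutoff x hr)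

lemma integrable_indicator_closedBall {d : ℕ} (μ : Measure (Euc d)) [IsLocallyFiniteMeasure μ]
    (x : Euc d) (r : ℝ) : Integrable ((closedBall x r).indicator (1 : Euc d → ℝ)) μ :=
  (integrable_indicator_iff measurableSet_closedBall).2
    (integrableOn_const measure_closedBall_lt_top.ne)

lemma real_closedBall_le_integral_ballCutoff {d : ℕ} (μ : Measure (Euc d))
    [IsLocallyFiniteMeasure μ] (x : Euc d) {r : ℝ} (hr : 0 < r) :
    μ.real (closedBall x r) ≤ ∫ y, ballCutoff x r y ∂μ := by
  rw [← integral_indicator_one measurableSet_closedBall]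
  refine integral_mono (integrable_indicator_closedBall μ x r) (integrable_ballCutoff μ x hr) ?_
  refine indicator_le' (fun y hy => ?_) (fun y _ => le_max_left _ _)
  have : dist y x / r ≤ 1 := by rw [div_le_one hr]; exact hy
  exact le_max_of_le_right (le_min le_rfl (by rw [Pi.one_apply]; linarith))

lemma integral_ballCutoff_le_real_closedBall {d : ℕ} (μ : Measure (Euc d))
    [IsLocallyFiniteMeasure μ] (x : Euc d) {r : ℝ} (hr : 0 < r) :
    ∫ y, ballCutoff x r y ∂μ ≤ μ.real (closedBall x (2 * r)) := by
  rw [← integral_indicator_one measurableSet_closedBall]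
  refine integral_mono (integrable_ballCutoff μ x hr) (integrable_indicator_closedBall μ x _) ?_
  intro y
  by_cases hy : y ∈ closedBall x (2 * r)
  · rw [indicator_of_mem hy]
    exact max_le zero_le_one (min_le_left _ _)
  · rw [indicator_of_notMem hy, ballCutoff_eq_zero hr hy]

lemma WeakConv.eventually_lt_real_closedBall {d : ℕ} {μs : ℕ → Measure (Euc d)}
    {μ : Measure (Euc d)} [IsLocallyFiniteMeasure μ] [∀ j, IsLocallyFiniteMeasure (μs j)]
    (h : WeakConv μs μ) {x : Euc d} {r a : ℝ} (hr : 0 < r) (ha : a < μ.real (closedBall x r)) :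
    ∀ᶠ j in atTop, a < (μs j).real (closedBall x (2 * r)) := by
  filter_upwards [(h _ (continuous_ballCutoff x r)
    (hasCompactSupport_ballCutoff x hr)).eventually_const_lt
      (ha.trans_le (real_closedBall_le_integral_ballCutoff μ x hr))] with j hj
  exact hj.trans_le (integral_ballCutoff_le_real_closedBall _ x hr)

lemma WeakConv.eventually_real_closedBall_lt {d : ℕ} {μs : ℕ → Measure (Euc d)}
    {μ : Measure (Euc d)} [IsLocallyFiniteMeasure μ] [∀ j, IsLocallyFiniteMeasure (μs j)]
    (h : WeakConv μs μ) {x : Euc d} {r a : ℝ} (hr : 0 < r)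
    (ha : μ.real (closedBall x (2 * r)) < a) :
    ∀ᶠ j in atTop, (μs j).real (closedBall x r) < a := by
  filter_upwards [(h _ (continuous_ballCutoff x r)
    (hasCompactSupport_ballCutoff x hr)).eventually_lt_const
      ((integral_ballCutoff_le_real_closedBall μ x hr).trans_lt ha)] with j hj
  exact (real_closedBall_le_integral_ballCutoff _ x hr).trans_lt hj

/-- Points of the limit support in a fixed ball are approximated uniformly by the supports of a
weakly convergent sequence. -/
lemma WeakConv.eventually_msupport_near {d : ℕ} {μs : ℕ → Measure (Euc d)}
    {μ : Measure (Euc d)} [IsLocallyFiniteMeasure μ] [∀ j, IsLocallyFiniteMeasure (μs j)]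
    (h : WeakConv μs μ) (x : Euc d) (R : ℝ) {δ : ℝ} (hδ : 0 < δ) :
    ∀ᶠ j in atTop, ∀ y ∈ msupport μ ∩ closedBall x R, ∃ z ∈ msupport (μs j), dist y z ≤ δ := by
  have hρ : 0 < δ / 3 := by positivity
  obtain ⟨N, hNsub, hNfin, hN⟩ := finite_approx_of_totallyBounded
    ((isCompact_closedBall x R).totallyBounded.subset
      (inter_subset_right (s := msupport μ))) (δ / 3) hρ
  filter_upwards [(eventually_all_finite hNfin).2 fun c hc =>
    h.eventually_lt_real_closedBall hρ (real_closedBall_pos (hNsub hc).1 hρ)] with j hj y hy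
  obtain ⟨c, hc, hyc⟩ := mem_iUnion₂.1 (hN hy)
  obtain ⟨z, hz, hzc⟩ := exists_mem_msupport_of_pos (hj c hc)
  refine ⟨z, hz, (dist_triangle_right y z c).trans ?_⟩
  rw [mem_ball] at hyc
  rw [mem_closedBall] at hzc
  linarith

/-- For uniformly doubling measures, the supports of a weakly convergent sequence eventually lie,
in a fixed ball, uniformly close to the support of the limit. -/
lemma WeakConv.eventually_near_msupport {d : ℕ} {μs : ℕ → Measure (Euc d)}
    {μ : Measure (Euc d)} [IsLocallyFiniteMeasure μ] [∀ j, IsLocallyFiniteMeasure (μs j)]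
    (h : WeakConv μs μ) {C : ℝ} (hC : 0 < C) (hdoub : ∀ j, DoublingWith (μs j) C)
    (hμ : (msupport μ).Nonempty) (x : Euc d) (R : ℝ) {δ : ℝ} (hδ : 0 < δ) :
    ∀ᶠ j in atTop, ∀ y ∈ msupport (μs j) ∩ closedBall x R, ∃ z ∈ msupport μ, dist y z ≤ δ := by
  obtain ⟨s, hs⟩ := hμ
  obtain ⟨ρ, hρ, rfl⟩ : ∃ ρ, 0 < ρ ∧ δ = 5 * ρ := ⟨δ / 5, by positivity, by ring⟩
  obtain ⟨N, -, hNfin, hN⟩ := finite_approx_of_totallyBounded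
    (isCompact_closedBall x R).totallyBounded ρ hρ
  obtain ⟨k, hk⟩ := pow_unbounded_of_one_lt ((R + dist x s + 2) / ρ) one_lt_two
  rw [div_lt_iff₀ hρ] at hk
  have hm := real_closedBall_pos hs one_pos
  set m := μ.real (closedBall s 1)
  have hfar : ∀ c ∈ N, ∀ᶠ j in atTop, (¬ ∃ z ∈ msupport μ, z ∈ closedBall c (2 * (2 * ρ))) →
      (μs j).real (closedBall c (2 * ρ)) < m / 2 / C ^ k := by
    intro c _
    by_cases hc : ∃ z ∈ msupport μ, z ∈ closedBall c (2 * (2 * ρ))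
    · exact .of_forall fun _ hc' => absurd hc hc'
    · have h0 : μ.real (closedBall c (2 * (2 * ρ))) ≤ 0 :=
        not_lt.1 fun h0 => hc (exists_mem_msupport_of_pos h0)
      filter_upwards [h.eventually_real_closedBall_lt (by positivity : 0 < 2 * ρ)
        (h0.trans_lt (by positivity : 0 < m / 2 / C ^ k))] with j hj _ using hj
  filter_upwards [(eventually_all_finite hNfin).2 hfar,
    h.eventually_lt_real_closedBall one_pos (half_lt_self hm)] with j hj hsj y ⟨hy, hyR⟩
  obtain ⟨c, hc, hyc⟩ := mem_iUnion₂.1 (hN hyR)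
  rw [mem_ball] at hyc
  by_cases hz : ∃ z ∈ msupport μ, z ∈ closedBall c (2 * (2 * ρ))
  · obtain ⟨z, hz, hzc⟩ := hz
    rw [mem_closedBall] at hzc
    exact ⟨z, hz, (dist_triangle_right y z c).trans (by linarith)⟩
  · exfalso
    have hsub : (μs j).real (closedBall s (2 * 1)) ≤ (μs j).real (closedBall y (2 ^ k * ρ)) := by
      refine measureReal_mono (closedBall_subset_closedBall' ?_) measure_closedBall_lt_top.ne
      rw [mem_closedBall] at hyR
      have := dist_triangle_left s y x
      rw [dist_comm x y] at this
      linarith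
    have hsmall : (μs j).real (closedBall y ρ) ≤ (μs j).real (closedBall c (2 * ρ)) :=
      measureReal_mono (closedBall_subset_closedBall' (by linarith)) measure_closedBall_lt_top.ne
    have hlt := hsmall.trans_lt (hj c hc hz)
    rw [lt_div_iff₀' (by positivity)] at hlt
    have := (hdoub j).real_closedBall_two_pow_le hC.le hy hρ k
    exact lt_irrefl _ (hsj.trans_le (hsub.trans (this.trans hlt.le)))

/-- The quantity minimised over planes `L` in the bilateral beta number, for sets `S` and `L`. -/
def bilateralGap {d : ℕ} (S L : Set (Euc d)) (x : Euc d) (r : ℝ) : ℝ :=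
  (⨆ y : (S ∩ closedBall x r : Set (Euc d)), infDist y.1 L / r) +
    (⨆ p : (L ∩ closedBall x r : Set (Euc d)), infDist p.1 S / r)

lemma bilateralBeta_eq_iInf_bilateralGap {d : ℕ} (n : ℕ) (μ : Measure (Euc d)) (x : Euc d)
    (r : ℝ) : bilateralBeta n μ x r = ⨅ L : nPlanes d n, bilateralGap (msupport μ) L.1 x r :=
  rfl

lemma bilateralGap_nonneg {d : ℕ} (S L : Set (Euc d)) (x : Euc d) {r : ℝ} (hr : 0 ≤ r) :
    0 ≤ bilateralGap S L x r :=
  add_nonneg (Real.iSup_nonneg fun _ => div_nonneg infDist_nonneg hr)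
    (Real.iSup_nonneg fun _ => div_nonneg infDist_nonneg hr)

lemma infDist_div_le {d : ℕ} (B : Set (Euc d)) {x y : Euc d} {r : ℝ} (hr : 0 < r)
    (hy : y ∈ closedBall x r) : infDist y B / r ≤ (infDist x B + r) / r := by
  gcongr
  exact infDist_le_infDist_add_dist.trans (by gcongr; exact hy)

lemma infDist_div_le_iSup {d : ℕ} (A B : Set (Euc d)) {x y : Euc d} {r : ℝ} (hr : 0 < r)
    (hyA : y ∈ A) (hy : y ∈ closedBall x r) :
    infDist y B / r ≤ ⨆ z : (A ∩ closedBall x r : Set (Euc d)), infDist z.1 B / r :=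
  le_ciSup (f := fun z : (A ∩ closedBall x r : Set (Euc d)) => infDist z.1 B / r)
    ⟨(infDist x B + r) / r, by rintro _ ⟨z, rfl⟩; exact infDist_div_le B hr z.2.2⟩ ⟨y, hyA, hy⟩

lemma bilateralGap_le {d : ℕ} (S L : Set (Euc d)) (x : Euc d) {r : ℝ} (hr : 0 < r) :
    bilateralGap S L x r ≤ (infDist x L + r) / r + (infDist x S + r) / r := by
  have hpos (B : Set (Euc d)) : 0 ≤ (infDist x B + r) / r :=
    div_nonneg (add_nonneg infDist_nonneg hr.le) hr.le
  exact add_le_add (Real.iSup_le (fun y => infDist_div_le L hr y.2.2) (hpos L))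
    (Real.iSup_le (fun y => infDist_div_le S hr y.2.2) (hpos S))

lemma bilateralGap_le_two_mul_add {d : ℕ} {S T : Set (Euc d)} (L : Set (Euc d))
    {x : Euc d} {r δ : ℝ} (hδ : 0 < δ) (hδr : δ ≤ r)
    (hT : (T ∩ closedBall x (2 * r)).Nonempty)
    (hST : ∀ y ∈ S ∩ closedBall x r, ∃ t ∈ T, dist y t ≤ δ)
    (hTS : ∀ t ∈ T ∩ closedBall x (5 * r), ∃ s ∈ S, dist t s ≤ δ) :
    bilateralGap S L x r ≤ 2 * bilateralGap T L x (2 * r) + 3 * δ / r := by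
  have hr : 0 < r := hδ.trans_le hδr
  have h2r : 0 < 2 * r := by positivity
  have hsup (A B : Set (Euc d)) :
      0 ≤ ⨆ z : (A ∩ closedBall x (2 * r) : Set (Euc d)), infDist z.1 B / (2 * r) :=
    Real.iSup_nonneg fun _ => div_nonneg infDist_nonneg h2r.le
  have h₁ : (⨆ y : (S ∩ closedBall x r : Set (Euc d)), infDist y.1 L / r) ≤
      2 * (⨆ y : (T ∩ closedBall x (2 * r) : Set (Euc d)), infDist y.1 L / (2 * r)) + δ / r := by
    refine Real.iSup_le ?_ (by have := hsup T L; positivity)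
    rintro ⟨y, hyS, hy⟩
    obtain ⟨t, ht, hyt⟩ := hST y ⟨hyS, hy⟩
    rw [mem_closedBall] at hy
    have htx : t ∈ closedBall x (2 * r) := by
      rw [mem_closedBall]
      have := dist_triangle_left t x y
      linarith
    calc infDist y L / r ≤ (infDist t L + δ) / r := by
          gcongr; exact infDist_le_infDist_add_dist.trans (by gcongr)
      _ = 2 * (infDist t L / (2 * r)) + δ / r := by field_simp
      _ ≤ _ := by gcongr; exact infDist_div_le_iSup T L h2r ht htx
  have h₂ : (⨆ p : (L ∩ closedBall x r : Set (Euc d)), infDist p.1 S / r) ≤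
      2 * (⨆ p : (L ∩ closedBall x (2 * r) : Set (Euc d)), infDist p.1 T / (2 * r)) +
        2 * δ / r := by
    refine Real.iSup_le ?_ (by have := hsup L T; positivity)
    rintro ⟨p, hpL, hp⟩
    have hp' := closedBall_subset_closedBall (by linarith : r ≤ 2 * r) hp
    rw [mem_closedBall] at hp
    obtain ⟨t₀, ht₀, ht₀x⟩ := hT
    rw [mem_closedBall] at ht₀x
    have hpT : infDist p T ≤ 3 * r :=
      (infDist_le_dist_of_mem ht₀).trans ((dist_triangle_right p t₀ x).trans (by linarith))
    obtain ⟨t, ht, hpt⟩ := (infDist_lt_iff ⟨t₀, ht₀⟩).1 (lt_add_of_pos_right (infDist p T) hδ)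
    obtain ⟨s, hs, hts⟩ := hTS t ⟨ht, by
      rw [mem_closedBall]
      have := dist_triangle_left t x p
      linarith⟩
    calc infDist p S / r ≤ (infDist p T + 2 * δ) / r := by
          gcongr
          exact (infDist_le_dist_of_mem hs).trans ((dist_triangle p t s).trans (by linarith))
      _ = 2 * (infDist p T / (2 * r)) + 2 * δ / r := by field_simp
      _ ≤ _ := by gcongr; exact infDist_div_le_iSup L T h2r hpL hp'
  calc bilateralGap S L x r ≤ _ := add_le_add h₁ h₂
    _ = _ := by unfold bilateralGap; ring

lemma bilateralBeta_nonneg {d : ℕ} (n : ℕ) (μ : Measure (Euc d)) (x : Euc d) {r : ℝ}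
    (hr : 0 ≤ r) : 0 ≤ bilateralBeta n μ x r :=
  Real.iInf_nonneg fun _ => bilateralGap_nonneg _ _ x hr

lemma bddBelow_bilateralGap {d : ℕ} (n : ℕ) (S : Set (Euc d)) (x : Euc d) {r : ℝ}
    (hr : 0 ≤ r) : BddBelow (range fun L : nPlanes d n => bilateralGap S L.1 x r) :=
  ⟨0, by rintro _ ⟨L, rfl⟩; exact bilateralGap_nonneg _ _ x hr⟩

lemma bilateralBeta_le_two_mul_add {d : ℕ} (n : ℕ) {μ ν : Measure (Euc d)}
    {x : Euc d} {r δ : ℝ} (hδ : 0 < δ) (hδr : δ ≤ r)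
    (hν : (msupport ν ∩ closedBall x (2 * r)).Nonempty)
    (hμν : ∀ y ∈ msupport μ ∩ closedBall x r, ∃ z ∈ msupport ν, dist y z ≤ δ)
    (hνμ : ∀ y ∈ msupport ν ∩ closedBall x (5 * r), ∃ z ∈ msupport μ, dist y z ≤ δ) :
    bilateralBeta n μ x r ≤ 2 * bilateralBeta n ν x (2 * r) + 3 * δ / r := by
  have hr : 0 < r := hδ.trans_le hδr
  simp only [bilateralBeta_eq_iInf_bilateralGap]
  cases isEmpty_or_nonempty (nPlanes d n) with
  | inl _ =>
    rw [Real.iInf_of_isEmpty, Real.iInf_of_isEmpty]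
    positivity
  | inr _ =>
    rw [← sub_le_iff_le_add, ← div_le_iff₀' two_pos]
    refine le_ciInf fun L => ?_
    rw [div_le_iff₀' two_pos, sub_le_iff_le_add]
    have hgap := bilateralGap_le_two_mul_add (L.1 : Set (Euc d)) hδ hδr hν hμν hνμ
    exact (ciInf_le (bddBelow_bilateralGap n (msupport μ) x hr.le) L).trans hgap

/-- The bilateral beta numbers on a fixed ball are uniformly bounded over all measures whose support
meets another fixed ball. -/
lemma exists_bilateralBeta_le {d : ℕ} (n : ℕ) (x : Euc d) {r : ℝ} (hr : 0 < r) (R : ℝ) :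
    ∃ M, ∀ ν : Measure (Euc d), (msupport ν ∩ closedBall x R).Nonempty →
      bilateralBeta n ν x r ≤ M := by
  simp only [bilateralBeta_eq_iInf_bilateralGap]
  cases isEmpty_or_nonempty (nPlanes d n) with
  | inl _ => exact ⟨0, fun ν _ => (Real.iInf_of_isEmpty _).le⟩
  | inr hne =>
    obtain ⟨L⟩ := hne
    refine ⟨(infDist x (L.1 : Set (Euc d)) + r) / r + (R + r) / r, fun ν ⟨s, hs, hsx⟩ => ?_⟩
    have hxs : infDist x (msupport ν) ≤ R :=
      (infDist_le_dist_of_mem hs).trans (by rw [dist_comm]; exact hsx)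
    have hgap := bilateralGap_le (msupport ν) (L.1 : Set (Euc d)) x hr
    refine (ciInf_le (bddBelow_bilateralGap n _ x hr.le) L).trans (hgap.trans ?_)
    gcongr

theorem bilateralBeta_semicontinuity_of_weakConv {d n : ℕ} (hn : 0 < n) (hnd : n ≤ d)
    (μs : ℕ → Measure (Euc d)) (μ : Measure (Euc d))
    [IsLocallyFiniteMeasure μ] (hls : ∀ j, IsLocallyFiniteMeasure (μs j))
    (C : ℝ) (hC : 0 < C)
    (hdoub : ∀ j, DoublingWith (μs j) C) (hdoubμ : DoublingWith μ C)
    (x₀ : Euc d) (r₀ : ℝ) (hr₀ : 0 < r₀)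
    (hS : (msupport μ ∩ Metric.closedBall x₀ r₀).Nonempty)
    (hSj : ∀ j, (msupport (μs j) ∩ Metric.closedBall x₀ r₀).Nonempty)
    (hconv : WeakConv μs μ) :
    (1/2 : ℝ) * Filter.limsup (fun j => bilateralBeta n (μs j) x₀ (r₀ / 2)) Filter.atTop
        ≤ bilateralBeta n μ x₀ r₀ ∧
    bilateralBeta n μ x₀ r₀
        ≤ 2 * Filter.liminf (fun j => bilateralBeta n (μs j) x₀ (2 * r₀)) Filter.atTop := by
  have hne : (msupport μ).Nonempty := hS.mono inter_subset_left
  have hclose (R δ : ℝ) (hδ : 0 < δ) := (hconv.eventually_msupport_near x₀ R hδ).and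
    (hconv.eventually_near_msupport hC hdoub hne x₀ R hδ)
  have hsub {r : ℝ} (hr : r ≤ 5 * r₀) {ν : Measure (Euc d)} :
      msupport ν ∩ closedBall x₀ r ⊆ msupport ν ∩ closedBall x₀ (5 * r₀) :=
    inter_subset_inter_right _ (closedBall_subset_closedBall hr)
  constructor
  · rw [one_div, inv_mul_le_iff₀ two_pos]
    refine le_of_forall_pos_le_add fun ε hε => ?_
    obtain ⟨δ, hδ, hδr, hδε⟩ : ∃ δ, 0 < δ ∧ δ ≤ r₀ / 2 ∧ 3 * δ / (r₀ / 2) ≤ ε := by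
      refine ⟨min (r₀ / 2) (ε * (r₀ / 2) / 3), by positivity, min_le_left _ _, ?_⟩
      rw [div_le_iff₀ (by positivity)]
      linarith [min_le_right (r₀ / 2) (ε * (r₀ / 2) / 3)]
    refine limsup_le_of_le (IsBoundedUnder.isCoboundedUnder_le
      ⟨0, eventually_map.2 (.of_forall fun j => bilateralBeta_nonneg n _ x₀ (by positivity))⟩) ?_
    filter_upwards [hclose (5 * r₀) δ hδ] with j ⟨h₁, h₂⟩
    have hr : 2 * (r₀ / 2) = r₀ := by ring
    have := bilateralBeta_le_two_mul_add n hδ hδr (hr.symm ▸ hS)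
      (fun y hy => h₂ y (hsub (by linarith) hy)) (fun y hy => h₁ y (hsub (by linarith) hy))
    rw [hr] at this
    linarith
  · refine le_of_forall_pos_le_add fun ε hε => ?_
    obtain ⟨δ, hδ, hδr, hδε⟩ : ∃ δ, 0 < δ ∧ δ ≤ r₀ ∧ 3 * δ / r₀ ≤ ε := by
      refine ⟨min r₀ (ε * r₀ / 3), by positivity, min_le_left _ _, ?_⟩
      rw [div_le_iff₀ hr₀]
      linarith [min_le_right r₀ (ε * r₀ / 3)]
    rw [← sub_le_iff_le_add, ← div_le_iff₀' two_pos]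
    obtain ⟨M, hM⟩ := exists_bilateralBeta_le n x₀ (by positivity : 0 < 2 * r₀) r₀
    refine le_liminf_of_le (IsBoundedUnder.isCoboundedUnder_ge
      ⟨M, eventually_map.2 (.of_forall fun j => hM _ (hSj j))⟩) ?_
    filter_upwards [hclose (5 * r₀) δ hδ] with j ⟨h₁, h₂⟩
    have := bilateralBeta_le_two_mul_add n hδ hδr
      ((hSj j).mono (inter_subset_inter_right _ (closedBall_subset_closedBall (by linarith))))
      (fun y hy => h₁ y (hsub (by linarith) hy)) h₂
    rw [div_le_iff₀' two_pos]
    linarith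
end
end

section
/- Let μ be a uniformly distributed measure on ℝ^d with dim₀ μ = n and dim_∞ μ = p, and let R > 0. Then there exists c > 0, depending only on R, μ, n and d, such that for every z₀ ∈ supp μ and every r > 0 with 2r ≤ R: ∫_{2r < |y−z₀| ≤ R} |y−z₀|^{−(n+1)} dμ(y) ≤ c/r. -/
open MeasureTheory Metric Filter Set

noncomputable section

/-- A distribution function with lower dimension `n` at the origin is bounded by a multiple
of `r ^ n` on bounded intervals. -/
lemma IsDistributionFunction.exists_le_mul_pow {d n : ℕ} {μ : Measure (Euc d)}
    {φ : ℝ → ENNReal} (hφ : IsDistributionFunction μ φ) (hn : HasDim0 φ n)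
    {R : ℝ} (hR : 0 < R) :
    ∃ C : ℝ, 0 < C ∧ ∀ s : ℝ, 0 < s → s ≤ R → φ s ≤ ENNReal.ofReal (C * s ^ n) := by
  obtain ⟨⟨x, hx⟩, hfin, hball⟩ := hφ
  obtain ⟨c, hc, hlim⟩ := hn
  have hev : ∀ᶠ s in nhdsWithin (0 : ℝ) (Set.Ioi 0), (φ s).toReal / s ^ n < c + 1 :=
    hlim.eventually (gt_mem_nhds (by linarith))
  obtain ⟨δ, hδ, hsub⟩ := mem_nhdsGT_iff_exists_Ioo_subset.1 hev
  rw [Set.mem_Ioi] at hδ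
  have hmono : ∀ s, 0 < s → s ≤ R → (φ s).toReal ≤ (φ R).toReal := by
    intro s hs hsR
    refine ENNReal.toReal_mono (hfin R hR).2.ne ?_
    rw [← hball x hx s hs, ← hball x hx R hR]
    exact measure_mono (closedBall_subset_closedBall hsR)
  refine ⟨(c + 1) + (φ R).toReal / δ ^ n, by positivity, fun s hs hsR => ?_⟩
  rw [← ENNReal.ofReal_toReal (hfin s hs).2.ne]
  refine ENNReal.ofReal_le_ofReal ?_
  rw [add_mul]
  rcases lt_or_ge s δ with h | h
  · have h1 : (φ s).toReal / s ^ n < c + 1 := hsub ⟨hs, h⟩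
    rw [div_lt_iff₀ (by positivity)] at h1
    have h2 : 0 ≤ (φ R).toReal / δ ^ n * s ^ n := by positivity
    linarith
  · have h1 : (φ R).toReal ≤ (φ R).toReal / δ ^ n * s ^ n := by
      rw [div_mul_eq_mul_div, le_div_iff₀ (by positivity)]
      gcongr
    have h2 : 0 ≤ (c + 1) * s ^ n := by positivity
    linarith [hmono s hs hsR]

/-- Dyadic decomposition: a measure with growth at most `C * s ^ n` for balls centred at `z`
gives `dist · z ^ (-(n + 1))` integral at most `2 ^ (n + 1) * C / r` off the ball of radius `r`. -/
lemma lintegral_inv_dist_pow_le {X : Type*} [PseudoMetricSpace X] [MeasurableSpace X]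
    [OpensMeasurableSpace X] {ν : Measure X} {z : X} {n : ℕ} {C r : ℝ} (hC : 0 ≤ C) (hr : 0 < r)
    (hν : ∀ s : ℝ, 0 < s → ν (closedBall z s) ≤ ENNReal.ofReal (C * s ^ n)) :
    ∫⁻ y in {y | r ≤ dist y z}, ENNReal.ofReal ((dist y z ^ (n + 1))⁻¹) ∂ν ≤
      ENNReal.ofReal (2 ^ (n + 1) * C / r) := by
  let A : ℕ → Set X := fun k => {y | 2 ^ k * r ≤ dist y z ∧ dist y z ≤ 2 ^ (k + 1) * r}
  have hA : ∀ k, MeasurableSet (A k) := fun k =>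
    ((isClosed_le continuous_const (continuous_id.dist continuous_const)).inter
      (isClosed_le (continuous_id.dist continuous_const) continuous_const)).measurableSet
  have hcover : {y | r ≤ dist y z} ⊆ ⋃ k, A k := by
    intro y hy
    obtain ⟨k, hk1, hk2⟩ := exists_nat_pow_near ((one_le_div hr).2 hy) (one_lt_two (α := ℝ))
    exact mem_iUnion.2 ⟨k, (le_div_iff₀ hr).1 hk1, ((div_lt_iff₀ hr).1 hk2).le⟩
  have hterm : ∀ k, ∫⁻ y in A k, ENNReal.ofReal ((dist y z ^ (n + 1))⁻¹) ∂ν ≤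
      ENNReal.ofReal (2 ^ n * C / r * (1 / 2) ^ k) := by
    intro k
    calc ∫⁻ y in A k, ENNReal.ofReal ((dist y z ^ (n + 1))⁻¹) ∂ν
        ≤ ∫⁻ _ in A k, ENNReal.ofReal (((2 ^ k * r) ^ (n + 1))⁻¹) ∂ν := by
          refine setLIntegral_mono' (hA k) fun y hy => ENNReal.ofReal_le_ofReal ?_
          have := hy.1
          gcongr
      _ = ENNReal.ofReal (((2 ^ k * r) ^ (n + 1))⁻¹) * ν (A k) := setLIntegral_const _ _
      _ ≤ ENNReal.ofReal (((2 ^ k * r) ^ (n + 1))⁻¹) *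
            ENNReal.ofReal (C * (2 ^ (k + 1) * r) ^ n) := by
          gcongr
          exact (measure_mono fun y hy => hy.2).trans (hν _ (by positivity))
      _ = ENNReal.ofReal (2 ^ n * C / r * (1 / 2) ^ k) := by
          rw [← ENNReal.ofReal_mul (by positivity)]
          congr 1
          rw [pow_succ (2 : ℝ) k, mul_right_comm, mul_pow _ (2 : ℝ) n, pow_succ _ n, one_div_pow]
          field_simp
  calc ∫⁻ y in {y | r ≤ dist y z}, ENNReal.ofReal ((dist y z ^ (n + 1))⁻¹) ∂ν
      ≤ ∫⁻ y in ⋃ k, A k, ENNReal.ofReal ((dist y z ^ (n + 1))⁻¹) ∂ν :=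
        lintegral_mono_set hcover
    _ ≤ ∑' k, ∫⁻ y in A k, ENNReal.ofReal ((dist y z ^ (n + 1))⁻¹) ∂ν :=
        lintegral_iUnion_le _ _
    _ ≤ ∑' k : ℕ, ENNReal.ofReal (2 ^ n * C / r * (1 / 2) ^ k) := ENNReal.tsum_le_tsum hterm
    _ = ENNReal.ofReal (2 ^ (n + 1) * C / r) := by
        rw [← ENNReal.ofReal_tsum_of_nonneg (fun k => by positivity)
          (summable_geometric_two.mul_left _), tsum_mul_left, tsum_geometric_two]
        congr 1
        ring

theorem annulus_integral_bound {d n p : ℕ}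
    (μ : Measure (Euc d)) [IsLocallyFiniteMeasure μ]
    (φ : ℝ → ENNReal) (hφ : IsDistributionFunction μ φ)
    (hn : HasDim0 φ n) (hp : HasDimInfty φ p) (R : ℝ) (hR : 0 < R) :
    ∃ c : ℝ, 0 < c ∧ ∀ z₀ ∈ msupport μ, ∀ r : ℝ, 0 < r → 2 * r ≤ R →
      ∫⁻ y in {y : Euc d | 2 * r < dist y z₀ ∧ dist y z₀ ≤ R},
        ENNReal.ofReal ((dist y z₀ ^ (n + 1))⁻¹) ∂μ ≤ ENNReal.ofReal (c / r) := by
  obtain ⟨C, hC, hbound⟩ := hφ.exists_le_mul_pow hn hR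
  refine ⟨2 ^ (n + 1) * C, by positivity, fun z hz r hr _ => ?_⟩
  have hgrowth : ∀ s : ℝ, 0 < s →
      μ.restrict (closedBall z R) (closedBall z s) ≤ ENNReal.ofReal (C * s ^ n) := by
    intro s hs
    have hm : 0 < min s R := lt_min hs hR
    rw [Measure.restrict_apply measurableSet_closedBall]
    calc μ (closedBall z s ∩ closedBall z R)
        ≤ μ (closedBall z (min s R)) := measure_mono fun y hy => mem_closedBall.2 (le_min hy.1 hy.2)
      _ = φ (min s R) := hφ.2.2 z hz _ hm
      _ ≤ ENNReal.ofReal (C * min s R ^ n) := hbound _ hm (min_le_right _ _)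
      _ ≤ ENNReal.ofReal (C * s ^ n) := by
          gcongr
          exact min_le_left _ _
  refine le_trans ?_ (lintegral_inv_dist_pow_le hC.le hr hgrowth)
  rw [Measure.restrict_restrict (isClosed_le continuous_const (by fun_prop)).measurableSet]
  refine lintegral_mono_set fun y hy => ⟨?_, hy.2⟩
  have := hy.1
  show r ≤ dist y z
  linarith
end
end

section
/- Let μ be a uniformly distributed measure on ℝ^d with dim₀ μ = n and dim_∞ μ = p, let m be an integer with n < m ≤ d, let ε > 0, and let K ⊂ ℝ^d be a compact set with diam K > 0. Then there exist constants δ > 0 and τ > 0, depending only on ε, K, μ, n, m and d, with the following property: if B is a ball centered at a point of Σ∩K with radius r(B) ≤ diam K and β^m_μ(B) ≤ δ, then there exists a ball B′ ⊆ B centered at a point of Σ with r(B′) ≥ τ·r(B) and β^{m−1}_μ(B′) ≤ ε. -/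
open MeasureTheory Metric Filter Set

noncomputable section

open scoped InnerProductSpace

section Support

variable {d : ℕ} {μ : Measure (Euc d)}

lemma isClosed_msupport (μ : Measure (Euc d)) : IsClosed (msupport μ) := by
  rw [← isOpen_compl_iff, Metric.isOpen_iff]
  intro x hx
  simp only [msupport, mem_compl_iff, mem_ofPred_eq, not_forall, not_lt, nonpos_iff_eq_zero] at hx
  obtain ⟨r, hr, h0⟩ := hx
  refine ⟨r / 2, by positivity, fun y hy hy' => ?_⟩
  have hpos := hy' (r / 2) (by positivity)
  have hle : μ (closedBall y (r / 2)) ≤ μ (closedBall x r) :=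
    measure_mono (closedBall_subset_closedBall' (by rw [mem_ball] at hy; linarith))
  rw [h0] at hle
  exact absurd hpos (not_lt.mpr hle)

lemma ae_mem_msupport (μ : Measure (Euc d)) : ∀ᵐ z ∂μ, z ∈ msupport μ := by
  rw [ae_iff]
  refine measure_null_of_locally_null _ fun x hx => ?_
  simp only [msupport, mem_ofPred_eq, not_forall, not_lt, nonpos_iff_eq_zero] at hx
  obtain ⟨r, hr, h0⟩ := hx
  exact ⟨closedBall x r, mem_nhdsWithin_of_mem_nhds (closedBall_mem_nhds x hr), h0⟩

end Support

section Beta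

variable {d : ℕ} {μ : Measure (Euc d)}

lemma bddAbove_infDist_div (L : AffineSubspace ℝ (Euc d)) (hL : (L : Set (Euc d)).Nonempty)
    (S : Set (Euc d)) (x : Euc d) {r : ℝ} (hr : 0 < r) :
    BddAbove (range fun y : (S ∩ closedBall x r : Set (Euc d)) =>
      infDist y.1 (L : Set (Euc d)) / r) := by
  obtain ⟨q, hq⟩ := hL
  refine ⟨(r + dist x q) / r, ?_⟩
  rintro _ ⟨y, rfl⟩
  have hy : dist y.1 x ≤ r := y.2.2
  have := infDist_le_dist_of_mem (x := y.1) hq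
  have := dist_triangle y.1 x q
  dsimp only
  gcongr
  linarith

lemma jonesBeta_le {k : ℕ} {L : AffineSubspace ℝ (Euc d)} (hL : L ∈ nPlanes d k)
    {x : Euc d} {r ε : ℝ} (hr : 0 < r) (hε : 0 ≤ ε)
    (h : ∀ z ∈ msupport μ ∩ closedBall x r, infDist z (L : Set (Euc d)) ≤ ε * r) :
    jonesBeta k μ x r ≤ ε := by
  refine (ciInf_le ⟨0, ?_⟩ (⟨L, hL⟩ : nPlanes d k)).trans ?_
  · rintro _ ⟨L', rfl⟩
    exact Real.iSup_nonneg fun y => div_nonneg infDist_nonneg hr.le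
  · exact Real.iSup_le (fun y => (div_le_iff₀ hr).mpr (h y.1 y.2)) hε

lemma exists_nPlane_of_jonesBeta_lt {k : ℕ} (hk : k ≤ d) {x : Euc d} {r δ : ℝ} (hr : 0 < r)
    (h : jonesBeta k μ x r < δ) :
    ∃ L ∈ nPlanes d k, ∀ z ∈ msupport μ ∩ closedBall x r,
      infDist z (L : Set (Euc d)) ≤ δ * r := by
  have hne : Nonempty (nPlanes d k) := by
    obtain ⟨f, hf⟩ := exists_linearIndependent_of_le_finrank (R := ℝ) (M := Euc d) (n := k)
      (by simpa using hk)
    exact ⟨⟨AffineSubspace.mk' 0 (Submodule.span ℝ (range f)), AffineSubspace.mk'_nonempty _ _,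
      by rw [AffineSubspace.direction_mk']; simpa using finrank_span_eq_card hf⟩⟩
  obtain ⟨L, hL⟩ := exists_lt_of_ciInf_lt h
  refine ⟨L.1, L.2, fun z hz => ?_⟩
  rw [← div_le_iff₀ hr]
  exact (le_ciSup (bddAbove_infDist_div L.1 L.2.1 (msupport μ) x hr) ⟨z, hz⟩).trans hL.le

end Beta

section Plane

lemma exists_nPlane_pred {d m : ℕ} {L : AffineSubspace ℝ (Euc d)} (hL : L ∈ nPlanes d m)
    (y : Euc d) {e b : Euc d} (he : e ∈ L.direction) (he1 : ‖e‖ = 1) {c : ℝ} (hc : 0 < c)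
    (hb : c ≤ ⟪b, e⟫_ℝ) :
    ∃ L' ∈ nPlanes d (m - 1), ∀ z, infDist z (L' : Set (Euc d)) ≤
      infDist z (L : Set (Euc d)) + (|⟪b, z - y⟫_ℝ| +
        ‖b‖ * (infDist z (L : Set (Euc d)) + infDist y (L : Set (Euc d)))) / c := by
  obtain ⟨hne, hfin⟩ := hL
  set w := L.direction.starProjection b with hw
  have hproj : ∀ v ∈ L.direction, ⟪w, v⟫_ℝ = ⟪b, v⟫_ℝ := by
    intro v hv
    rw [hw, Submodule.inner_starProjection_left_eq_right,
      Submodule.starProjection_eq_self_iff.mpr hv]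
  have hwc : c ≤ ‖w‖ := by
    have := real_inner_le_norm w e
    rw [hproj e he, he1, mul_one] at this
    exact hb.trans this
  have hw0 : w ≠ 0 := norm_pos_iff.mp (hc.trans_le hwc)
  have hwmem : w ∈ L.direction := Submodule.starProjection_apply_mem _ _
  have hclosed : IsClosed (L : Set (Euc d)) := AffineSubspace.closed_of_finiteDimensional L
  obtain ⟨y', hy', hyd⟩ := hclosed.exists_infDist_eq_dist hne y
  refine ⟨AffineSubspace.mk' y' ((Submodule.span ℝ {w})ᗮ ⊓ L.direction),
    ⟨AffineSubspace.mk'_nonempty _ _, ?_⟩, fun z => ?_⟩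
  · have := Submodule.finrank_add_inf_finrank_orthogonal
      (show Submodule.span ℝ {w} ≤ L.direction by simpa using hwmem)
    rw [finrank_span_singleton hw0, hfin] at this
    rw [AffineSubspace.direction_mk']
    omega
  · obtain ⟨z', hz', hzd⟩ := hclosed.exists_infDist_eq_dist hne z
    have hdir : z' - y' ∈ L.direction := AffineSubspace.vsub_mem_direction hz' hy'
    set q := z' - (⟪w, z' - y'⟫_ℝ / ‖w‖ ^ 2) • w with hq
    have hqmem : q ∈ AffineSubspace.mk' y' ((Submodule.span ℝ {w})ᗮ ⊓ L.direction) := by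
      rw [AffineSubspace.mem_mk', vsub_eq_sub]
      have hqy : q - y' = (z' - y') - (⟪w, z' - y'⟫_ℝ / ‖w‖ ^ 2) • w := by rw [hq]; abel
      rw [hqy]
      refine ⟨?_, Submodule.sub_mem _ hdir (Submodule.smul_mem _ _ hwmem)⟩
      rw [SetLike.mem_coe, Submodule.mem_orthogonal_singleton_iff_inner_right, inner_sub_right,
        inner_smul_right,
        real_inner_self_eq_norm_sq]
      field_simp
      simp
    have h1 := infDist_le_dist_of_mem (x := z) (SetLike.mem_coe.mpr hqmem)
    have h2 := dist_triangle z z' q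
    have h3 : dist z' q = |⟪b, z' - y'⟫_ℝ| / ‖w‖ := by
      rw [dist_eq_norm, hq, sub_sub_cancel, norm_smul, hproj _ hdir, Real.norm_eq_abs, abs_div,
        abs_of_nonneg (by positivity : (0 : ℝ) ≤ ‖w‖ ^ 2)]
      have := norm_pos_iff.mpr hw0
      field_simp
    have h4 : |⟪b, z' - y'⟫_ℝ| ≤ |⟪b, z - y⟫_ℝ| + ‖b‖ * (dist z z' + dist y y') := by
      have hsplit : ⟪b, z' - y'⟫_ℝ = ⟪b, z - y⟫_ℝ + (-⟪b, z - z'⟫_ℝ + ⟪b, y - y'⟫_ℝ) := by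
        simp only [inner_sub_right]; ring
      rw [hsplit]
      have e1 := abs_real_inner_le_norm b (z - z')
      have e2 := abs_real_inner_le_norm b (y - y')
      rw [← dist_eq_norm] at e1 e2
      have e3 := abs_add_le ⟪b, z - y⟫_ℝ (-⟪b, z - z'⟫_ℝ + ⟪b, y - y'⟫_ℝ)
      have e4 := abs_add_le (-⟪b, z - z'⟫_ℝ) ⟪b, y - y'⟫_ℝ
      rw [abs_neg] at e4
      linarith
    have h5 : |⟪b, z' - y'⟫_ℝ| / ‖w‖ ≤
        (|⟪b, z - y⟫_ℝ| + ‖b‖ * (dist z z' + dist y y')) / c := by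
      gcongr
    rw [hzd, hyd]
    linarith

end Plane

section Moments

variable {d : ℕ} {μ : Measure (Euc d)}

lemma sq_posPart_setOf_le (x : Euc d) {s t : ℝ} (ht : 0 < t) :
    {z : Euc d | t ≤ (max (s ^ 2 - ‖z - x‖ ^ 2) 0) ^ 2} =
      {z | ‖z - x‖ ^ 2 ≤ s ^ 2 - √t} := by
  ext z
  simp only [mem_ofPred_eq]
  have hs : 0 < √t := Real.sqrt_pos.mpr ht
  rw [← Real.sqrt_le_left (le_max_right _ _), le_max_iff]
  constructor
  · rintro (h | h) <;> linarith
  · intro h; left; linarith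

lemma IsDistributionFunction.integral_sq_posPart_eq {φ : ℝ → ENNReal}
    (hφ : IsDistributionFunction μ φ) {x y : Euc d} (hx : x ∈ msupport μ) (hy : y ∈ msupport μ)
    (s : ℝ) :
    ∫ z, (max (s ^ 2 - ‖z - x‖ ^ 2) 0) ^ 2 ∂μ = ∫ z, (max (s ^ 2 - ‖z - y‖ ^ 2) 0) ^ 2 ∂μ := by
  have hcont : ∀ x : Euc d, Continuous fun z => (max (s ^ 2 - ‖z - x‖ ^ 2) 0) ^ 2 := by
    intro x; fun_prop
  have key : ∀ x : Euc d, ∫ z, (max (s ^ 2 - ‖z - x‖ ^ 2) 0) ^ 2 ∂μ =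
      (∫⁻ t in Ioi (0 : ℝ), μ {z | t ≤ (max (s ^ 2 - ‖z - x‖ ^ 2) 0) ^ 2}).toReal := by
    intro x
    rw [integral_eq_lintegral_of_nonneg_ae (Eventually.of_forall fun z => by positivity)
      (hcont x).aestronglyMeasurable,
      lintegral_eq_lintegral_meas_le μ (Eventually.of_forall fun z => by positivity)
        (hcont x).aemeasurable]
  rw [key x, key y]
  congr 1
  refine lintegral_congr_ae ?_
  have hne : ∀ᵐ t ∂(volume.restrict (Ioi (0 : ℝ))), t ≠ (s ^ 2) ^ 2 :=
    ae_restrict_of_ae (Measure.ae_ne volume _)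
  filter_upwards [hne, ae_restrict_mem measurableSet_Ioi] with t ht ht0
  rw [sq_posPart_setOf_le x ht0, sq_posPart_setOf_le y ht0]
  rcases lt_or_ge 0 (s ^ 2 - √t) with h | h
  · have hball : ∀ x : Euc d, {z : Euc d | ‖z - x‖ ^ 2 ≤ s ^ 2 - √t} =
        closedBall x (√(s ^ 2 - √t)) := by
      intro x; ext z
      rw [mem_closedBall, dist_eq_norm, Real.le_sqrt (norm_nonneg _) h.le]
      rfl
    rw [hball, hball, hφ.2.2 x hx _ (Real.sqrt_pos.mpr h), hφ.2.2 y hy _ (Real.sqrt_pos.mpr h)]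
  · have hlt : s ^ 2 - √t < 0 := by
      refine lt_of_le_of_ne h fun h0 => ht ?_
      rw [show s ^ 2 = √t by linarith, Real.sq_sqrt (le_of_lt ht0)]
    have hempty : ∀ x : Euc d, {z : Euc d | ‖z - x‖ ^ 2 ≤ s ^ 2 - √t} = ∅ := by
      intro x
      ext z
      simp only [mem_ofPred_eq, mem_empty_iff_false, iff_false, not_le]
      exact hlt.trans_le (by positivity)
    rw [hempty, hempty]

/-- The first moment of `μ` about `y`, weighted by the bump `(s² - |z - y|²)₊`. -/
def localMoment (μ : Measure (Euc d)) (y : Euc d) (s : ℝ) : Euc d :=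
  ∫ z, max (s ^ 2 - ‖z - y‖ ^ 2) 0 • (z - y) ∂μ

lemma posPart_eq_zero_of_notMem {s : ℝ} (hs : 0 ≤ s) {y z : Euc d} (hz : z ∉ closedBall y s) :
    max (s ^ 2 - ‖z - y‖ ^ 2) 0 = 0 := by
  rw [mem_closedBall, dist_eq_norm, not_le] at hz
  exact max_eq_right (by nlinarith)

lemma posPart_le (s : ℝ) (y z : Euc d) : max (s ^ 2 - ‖z - y‖ ^ 2) 0 ≤ s ^ 2 :=
  max_le (by nlinarith [sq_nonneg ‖z - y‖]) (sq_nonneg s)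

lemma integrable_of_eq_zero_off_closedBall [IsLocallyFiniteMeasure μ] {E : Type*}
    [NormedAddCommGroup E] {f : Euc d → E} (hf : Continuous f)
    {y : Euc d} {s : ℝ} (h : ∀ z ∉ closedBall y s, f z = 0) : Integrable f μ :=
  hf.integrable_of_hasCompactSupport (HasCompactSupport.intro (isCompact_closedBall y s) h)

lemma integrable_localMoment [IsLocallyFiniteMeasure μ] (y : Euc d) {s : ℝ} (hs : 0 ≤ s) :
    Integrable (fun z => max (s ^ 2 - ‖z - y‖ ^ 2) 0 • (z - y)) μ :=
  integrable_of_eq_zero_off_closedBall (by fun_prop) fun z hz => by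
    rw [posPart_eq_zero_of_notMem hs hz, zero_smul]

lemma inner_localMoment [IsLocallyFiniteMeasure μ] (y h : Euc d) {s : ℝ} (hs : 0 ≤ s) :
    ⟪localMoment μ y s, h⟫_ℝ = ∫ z, max (s ^ 2 - ‖z - y‖ ^ 2) 0 * ⟪z - y, h⟫_ℝ ∂μ := by
  rw [localMoment, real_inner_comm, ← integral_inner (integrable_localMoment y hs)]
  simp only [inner_smul_right, real_inner_comm]

lemma abs_integral_le_of_bound_closedBall [IsLocallyFiniteMeasure μ] {E : Type*}
    [NormedAddCommGroup E] [NormedSpace ℝ E] {f : Euc d → E} {y : Euc d} {s c : ℝ}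
    (h0 : ∀ z ∉ closedBall y s, f z = 0) (h : ∀ z ∈ closedBall y s, ‖f z‖ ≤ c) :
    ‖∫ z, f z ∂μ‖ ≤ c * μ.real (closedBall y s) := by
  rw [← setIntegral_eq_integral_of_forall_compl_eq_zero h0]
  exact norm_setIntegral_le_of_norm_le_const (measure_closedBall_lt_top) h

lemma norm_localMoment_le [IsLocallyFiniteMeasure μ] (y : Euc d) {s : ℝ} (hs : 0 ≤ s) :
    ‖localMoment μ y s‖ ≤ s ^ 3 * μ.real (closedBall y s) := by
  refine abs_integral_le_of_bound_closedBall (fun z hz => ?_) fun z hz => ?_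
  · rw [posPart_eq_zero_of_notMem hs hz, zero_smul]
  · rw [norm_smul, Real.norm_of_nonneg (le_max_right _ _), pow_succ]
    rw [mem_closedBall, dist_eq_norm] at hz
    exact mul_le_mul (posPart_le s y z) hz (norm_nonneg _) (sq_nonneg s)

lemma sq_posPart_add_taylor (A u : ℝ) :
    |max (A + u) 0 ^ 2 - max A 0 ^ 2 - 2 * max A 0 * u| ≤ u ^ 2 := by
  rw [abs_le]
  rcases le_total A 0 with hA | hA <;> rcases le_total (A + u) 0 with hB | hB <;>
    simp only [max_eq_left, max_eq_right, hA, hB] <;> constructor <;>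
    nlinarith [sq_nonneg (A + u), sq_nonneg u, sq_nonneg A]

lemma IsDistributionFunction.abs_inner_localMoment_le [IsLocallyFiniteMeasure μ]
    {φ : ℝ → ENNReal} (hφ : IsDistributionFunction μ φ) {x y : Euc d}
    (hx : x ∈ msupport μ) (hy : y ∈ msupport μ) {s : ℝ} (hs : 0 ≤ s) (hxy : ‖x - y‖ ≤ s) :
    |⟪localMoment μ y s, x - y⟫_ℝ| ≤
      7 * s ^ 2 * ‖x - y‖ ^ 2 * μ.real (closedBall y (2 * s)) := by
  set h := x - y with hh
  have hzx : ∀ z, z - x = (z - y) - h := fun z => by rw [hh]; abel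
  set F : Euc d → ℝ := fun z => max (s ^ 2 - ‖z - x‖ ^ 2) 0 ^ 2 - max (s ^ 2 - ‖z - y‖ ^ 2) 0 ^ 2
    - 4 * (max (s ^ 2 - ‖z - y‖ ^ 2) 0 * ⟪z - y, h⟫_ℝ) with hF
  have i1 : Integrable (fun z => max (s ^ 2 - ‖z - x‖ ^ 2) 0 ^ 2) μ :=
    integrable_of_eq_zero_off_closedBall (by fun_prop) fun z hz => by
      rw [posPart_eq_zero_of_notMem hs hz]; norm_num
  have i2 : Integrable (fun z => max (s ^ 2 - ‖z - y‖ ^ 2) 0 ^ 2) μ :=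
    integrable_of_eq_zero_off_closedBall (by fun_prop) fun z hz => by
      rw [posPart_eq_zero_of_notMem hs hz]; norm_num
  have i3 : Integrable (fun z => max (s ^ 2 - ‖z - y‖ ^ 2) 0 * ⟪z - y, h⟫_ℝ) μ :=
    integrable_of_eq_zero_off_closedBall (by fun_prop) fun z hz => by
      rw [posPart_eq_zero_of_notMem hs hz, zero_mul]
  have hint : ∫ z, F z ∂μ = -(4 * ⟪localMoment μ y s, h⟫_ℝ) := by
    have hsub := integral_sub (i1.sub i2) (i3.const_mul 4)
    simp only [Pi.sub_apply] at hsub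
    rw [hF, hsub, integral_sub i1 i2,
      hφ.integral_sq_posPart_eq hx hy s, integral_const_mul, inner_localMoment y h hs]
    ring
  have hbound : ‖∫ z, F z ∂μ‖ ≤ (27 * s ^ 2 * ‖h‖ ^ 2) * μ.real (closedBall y (2 * s)) := by
    refine abs_integral_le_of_bound_closedBall (fun z hz => ?_) fun z hz => ?_
    · have hzy : z ∉ closedBall y s := fun h' =>
        hz (closedBall_subset_closedBall (by linarith) h')
      have hzx' : z ∉ closedBall x s := fun h' => by
        refine hz (closedBall_subset_closedBall' ?_ h')
        rw [dist_eq_norm, ← hh]; linarith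
      simp only [hF]
      rw [posPart_eq_zero_of_notMem hs hzy, posPart_eq_zero_of_notMem hs hzx']
      ring
    · rw [mem_closedBall, dist_eq_norm] at hz
      set A := s ^ 2 - ‖z - y‖ ^ 2 with hA
      set u := 2 * ⟪z - y, h⟫_ℝ - ‖h‖ ^ 2 with hu
      have hAu : s ^ 2 - ‖z - x‖ ^ 2 = A + u := by
        rw [hzx, norm_sub_sq_real, hA, hu]; ring
      have hin := abs_real_inner_le_norm (z - y) h
      have hin' : |⟪z - y, h⟫_ℝ| ≤ 2 * s * ‖h‖ :=
        hin.trans (mul_le_mul_of_nonneg_right hz (norm_nonneg _))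
      have hu5 : |u| ≤ 5 * (s * ‖h‖) := by
        rw [abs_le] at hin' ⊢
        have := mul_le_mul_of_nonneg_right hxy (norm_nonneg h)
        have := mul_nonneg hs (norm_nonneg h)
        constructor <;> nlinarith [hin'.1, hin'.2, sq_nonneg ‖h‖]
      have hu2 : u ^ 2 ≤ 25 * s ^ 2 * ‖h‖ ^ 2 := by
        have := sq_le_sq' (abs_le.mp hu5).1 (abs_le.mp hu5).2
        nlinarith
      have ht := sq_posPart_add_taylor A u
      have hm : max A 0 ≤ s ^ 2 := posPart_le s y z
      have hm0 : 0 ≤ max A 0 := le_max_right _ _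
      have hFz : F z = (max (A + u) 0 ^ 2 - max A 0 ^ 2 - 2 * max A 0 * u)
          + -(2 * (max A 0 * ‖h‖ ^ 2)) := by
        simp only [hF]
        rw [hAu, hu]; ring
      have hmh : max A 0 * ‖h‖ ^ 2 ≤ s ^ 2 * ‖h‖ ^ 2 := by gcongr
      have hmh0 : 0 ≤ max A 0 * ‖h‖ ^ 2 := by positivity
      rw [Real.norm_eq_abs, hFz]
      refine (abs_add_le _ _).trans ?_
      rw [abs_neg, abs_of_nonneg (by positivity : 0 ≤ 2 * (max A 0 * ‖h‖ ^ 2))]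
      linarith
  rw [hint, norm_neg, Real.norm_eq_abs, abs_mul, abs_of_pos (by norm_num : (0 : ℝ) < 4)] at hbound
  have : 0 ≤ s ^ 2 * ‖h‖ ^ 2 * μ.real (closedBall y (2 * s)) := by positivity
  linarith

lemma le_inner_localMoment [IsLocallyFiniteMeasure μ] {y z₀ e : Euc d} (he : ‖e‖ = 1)
    {s η ρ : ℝ} (hs : 0 < s) (hη : 0 ≤ η) (hρ : 0 < ρ) (hρ1 : ρ ≤ 1 / 4)
    (hhalf : ∀ z ∈ msupport μ, ‖z - y‖ ≤ s → -(η * s) ≤ ⟪z - y, e⟫_ℝ)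
    (hz₀ : ‖z₀ - y‖ ≤ s / 2) (hz₀e : 2 * ρ * s ≤ ⟪z₀ - y, e⟫_ℝ) :
    s ^ 3 * (ρ / 4 * μ.real (closedBall z₀ (ρ * s)) - η * μ.real (closedBall y s)) ≤
      ⟪localMoment μ y s, e⟫_ℝ := by
  rw [inner_localMoment y e hs.le]
  have i3 : Integrable (fun z => max (s ^ 2 - ‖z - y‖ ^ 2) 0 * ⟪z - y, e⟫_ℝ) μ :=
    integrable_of_eq_zero_off_closedBall (by fun_prop) fun z hz => by
      rw [posPart_eq_zero_of_notMem hs.le hz, zero_mul]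
  have iind : ∀ (x : Euc d) (r c : ℝ),
      Integrable ((closedBall x r).indicator fun _ => c) μ := fun x r c =>
    (integrable_indicator_iff measurableSet_closedBall).mpr
      (integrableOn_const measure_closedBall_lt_top.ne)
  have hval : ∀ (x : Euc d) (r c : ℝ),
      ∫ z, (closedBall x r).indicator (fun _ => c) z ∂μ = μ.real (closedBall x r) * c := by
    intro x r c
    rw [integral_indicator_const c measurableSet_closedBall, smul_eq_mul]
  calc s ^ 3 * (ρ / 4 * μ.real (closedBall z₀ (ρ * s)) - η * μ.real (closedBall y s))
      = ∫ z, ((closedBall z₀ (ρ * s)).indicator (fun _ => s ^ 3 * (ρ / 4)) z -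
          (closedBall y s).indicator (fun _ => s ^ 3 * η) z) ∂μ := by
        rw [integral_sub (iind _ _ _) (iind _ _ _), hval, hval]; ring
    _ ≤ _ := by
        refine integral_mono_ae ((iind _ _ _).sub (iind _ _ _)) i3 ?_
        filter_upwards [ae_mem_msupport μ] with z hz
        by_cases hzy : z ∈ closedBall y s
        · have hzy' : ‖z - y‖ ≤ s := by rwa [mem_closedBall, dist_eq_norm] at hzy
          have hlow := hhalf z hz hzy'
          have hw0 : 0 ≤ max (s ^ 2 - ‖z - y‖ ^ 2) 0 := le_max_right _ _
          have hw := posPart_le s y z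
          rw [indicator_of_mem hzy]
          by_cases hzz : z ∈ closedBall z₀ (ρ * s)
          · rw [indicator_of_mem hzz]
            rw [mem_closedBall, dist_eq_norm] at hzz
            have hsplit : z - y = (z - z₀) + (z₀ - y) := by abel
            have hn : ‖z - y‖ ≤ 3 / 4 * s := by
              rw [hsplit]
              refine (norm_add_le _ _).trans ?_
              nlinarith
            have hin : ρ * s ≤ ⟪z - y, e⟫_ℝ := by
              rw [hsplit, inner_add_left]
              have := (abs_le.mp (abs_real_inner_le_norm (z - z₀) e)).1
              rw [he, mul_one] at this
              linarith
            have hw' : s ^ 2 / 4 ≤ max (s ^ 2 - ‖z - y‖ ^ 2) 0 := by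
              refine le_max_of_le_left ?_
              nlinarith [norm_nonneg (z - y)]
            have := mul_le_mul hw' hin (by positivity) hw0
            have : 0 ≤ s ^ 3 * η := by positivity
            linarith
          · rw [indicator_of_notMem hzz]
            have h1 := mul_le_mul_of_nonneg_left hlow hw0
            have h2 := mul_le_mul_of_nonneg_right hw (by positivity : 0 ≤ η * s)
            linarith
        · have hzz : z ∉ closedBall z₀ (ρ * s) := fun h' => by
            refine hzy (closedBall_subset_closedBall' ?_ h')
            rw [dist_eq_norm]; nlinarith
          rw [indicator_of_notMem hzy, indicator_of_notMem hzz,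
            posPart_eq_zero_of_notMem hs.le hzy]
          simp

end Moments

section Regularity

variable {d : ℕ} {μ : Measure (Euc d)}

/-- `μ` is Ahlfors `n`-regular with constant `C` at all scales in `(0, R]`. -/
def RegularUpTo (μ : Measure (Euc d)) (n : ℕ) (C R : ℝ) : Prop :=
  ∀ x ∈ msupport μ, ∀ r : ℝ, 0 < r → r ≤ R →
    r ^ n ≤ C * μ.real (closedBall x r) ∧ μ.real (closedBall x r) ≤ C * r ^ n

lemma RegularUpTo.mono {n : ℕ} {C R R' : ℝ} (h : RegularUpTo μ n C R) (hR : R' ≤ R) :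
    RegularUpTo μ n C R' :=
  fun x hx r hr hr' => h x hx r hr (hr'.trans hR)

lemma IsDistributionFunction.exists_regularUpTo [IsLocallyFiniteMeasure μ] {φ : ℝ → ENNReal}
    (hφ : IsDistributionFunction μ φ) {n : ℕ} (hn : HasDim0 φ n) (R : ℝ) :
    ∃ C : ℝ, 1 ≤ C ∧ RegularUpTo μ n C R := by
  obtain ⟨c, hc, hlim⟩ := hn
  have hev : ∀ᶠ r in nhdsWithin (0 : ℝ) (Ioi 0),
      (φ r).toReal / r ^ n ∈ Ioo (c / 2) (2 * c) :=
    hlim (Ioo_mem_nhds (by linarith) (by linarith))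
  obtain ⟨r₀, hr₀, hsmall⟩ := mem_nhdsGT_iff_exists_Ioo_subset.mp hev
  rw [mem_Ioi] at hr₀
  set a := r₀ / 2 with ha
  have ha0 : 0 < a := by positivity
  set R' := max R a with hR'
  have hR0 : 0 < R' := lt_max_of_lt_right ha0
  have hpos : ∀ r, 0 < r → 0 < (φ r).toReal := fun r hr =>
    ENNReal.toReal_pos (hφ.2.1 r hr).1.ne' (hφ.2.1 r hr).2.ne
  have hreal : ∀ x ∈ msupport μ, ∀ r, 0 < r → μ.real (closedBall x r) = (φ r).toReal :=
    fun x hx r hr => by rw [measureReal_def, hφ.2.2 x hx r hr]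
  have hmono : ∀ r r', 0 < r → r ≤ r' → (φ r).toReal ≤ (φ r').toReal := by
    obtain ⟨x, hx⟩ := hφ.1
    intro r r' hr hrr'
    rw [← hreal x hx r hr, ← hreal x hx r' (hr.trans_le hrr')]
    exact measureReal_mono (closedBall_subset_closedBall hrr') measure_closedBall_lt_top.ne
  have hpa := hpos a ha0
  have hpR := hpos R' hR0
  have t1 : 0 < 2 / c := by positivity
  have t2 : 0 < (φ R').toReal / a ^ n := by positivity
  have t3 : 0 < R' ^ n / (φ a).toReal := by positivity
  refine ⟨1 + 2 * c + 2 / c + (φ R').toReal / a ^ n + R' ^ n / (φ a).toReal, by linarith,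
    fun x hx r hr hrR => ?_⟩
  rw [hreal x hx r hr]
  have hpr := hpos r hr
  have hrn : 0 < r ^ n := by positivity
  rcases le_or_gt r a with h | h
  · obtain ⟨h1, h2⟩ : (φ r).toReal / r ^ n ∈ Ioo (c / 2) (2 * c) :=
      hsmall ⟨hr, by rw [ha] at h; linarith⟩
    rw [lt_div_iff₀ hrn] at h1
    rw [div_lt_iff₀ hrn] at h2
    constructor
    · have h3 : r ^ n ≤ 2 / c * (φ r).toReal := by
        rw [div_mul_eq_mul_div, le_div_iff₀ hc]; linarith
      refine h3.trans (mul_le_mul_of_nonneg_right ?_ hpr.le)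
      linarith
    · refine h2.le.trans (mul_le_mul_of_nonneg_right ?_ hrn.le)
      linarith
  · have hrR' : r ≤ R' := hrR.trans (le_max_left _ _)
    constructor
    · have h3 : r ^ n ≤ R' ^ n / (φ a).toReal * (φ r).toReal := by
        rw [div_mul_eq_mul_div, le_div_iff₀ hpa]
        have := hmono a r ha0 h.le
        gcongr
      refine h3.trans (mul_le_mul_of_nonneg_right ?_ hpr.le)
      linarith
    · have h3 : (φ r).toReal ≤ (φ R').toReal / a ^ n * r ^ n := by
        rw [div_mul_eq_mul_div, le_div_iff₀ (by positivity)]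
        have := hmono r R' hr hrR'
        gcongr
      refine h3.trans (mul_le_mul_of_nonneg_right ?_ hrn.le)
      linarith

lemma exists_separated_family {m : ℕ} {L : AffineSubspace ℝ (Euc d)} (hL : L ∈ nPlanes d m)
    {q : Euc d} (hq : q ∈ L) (N : ℕ) {a : ℝ} (ha : 0 ≤ a) :
    ∃ g : (Fin m → Fin N) → Euc d, (∀ k, g k ∈ L) ∧ (∀ k, dist (g k) q ≤ a * N * m) ∧
      ∀ k l, k ≠ l → a ≤ dist (g k) (g l) := by
  set ι := ((stdOrthonormalBasis ℝ L.direction).reindex (finCongr hL.2)).repr.symm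
  set v : (Fin m → Fin N) → EuclideanSpace ℝ (Fin m) :=
    fun k => WithLp.toLp 2 fun i => a * ((k i : ℕ) : ℝ) with hv
  refine ⟨fun k => (ι (v k) : Euc d) + q, fun k => ?_, fun k => ?_, fun k l hkl => ?_⟩
  · exact AffineSubspace.vadd_mem_of_mem_direction (ι (v k)).2 hq
  · rw [dist_eq_norm, add_sub_cancel_right, ← Submodule.coe_norm, ι.norm_map,
      EuclideanSpace.norm_eq]
    apply Real.sqrt_le_iff.mpr ⟨by positivity, ?_⟩
    have hterm : ∀ i ∈ (Finset.univ : Finset (Fin m)), ‖v k i‖ ^ 2 ≤ (a * N) ^ 2 := by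
      intro i _
      have hk : ((k i : ℕ) : ℝ) ≤ N := by exact_mod_cast (k i).2.le
      simp only [hv, Real.norm_eq_abs, sq_abs]
      gcongr
    refine (Finset.sum_le_sum hterm).trans ?_
    rw [Finset.sum_const, Finset.card_univ, Fintype.card_fin, nsmul_eq_mul, mul_pow (a * N) _ 2,
      mul_comm]
    gcongr
    exact_mod_cast Nat.le_self_pow two_ne_zero m
  · obtain ⟨i, hi⟩ := Function.ne_iff.mp hkl
    rw [dist_eq_norm, add_sub_add_right_eq_sub, ← Submodule.coe_sub, ← Submodule.coe_norm,
      ← map_sub, ι.norm_map]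
    refine le_trans ?_ (PiLp.norm_apply_le (v k - v l) i)
    have hne : ((k i : ℕ) : ℤ) - ((l i : ℕ) : ℤ) ≠ 0 := by
      rw [sub_ne_zero]
      exact_mod_cast fun h => hi (Fin.ext h)
    have h1 : (1 : ℝ) ≤ |((k i : ℕ) : ℝ) - ((l i : ℕ) : ℝ)| := by
      exact_mod_cast Int.one_le_abs hne
    have h2 : (v k - v l) i = a * (((k i : ℕ) : ℝ) - ((l i : ℕ) : ℝ)) := by
      simp only [hv, PiLp.sub_apply]; ring
    rw [h2, Real.norm_eq_abs, abs_mul, abs_of_nonneg ha]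
    exact le_mul_of_one_le_right ha h1

lemma exists_empty_ball_centered_in_plane {n m : ℕ} (hnm : n < m) {C : ℝ} (hC : 1 ≤ C) :
    ∃ θ : ℝ, 0 < θ ∧ θ ≤ 1 / 40 ∧ ∀ (μ : Measure (Euc d)) [IsLocallyFiniteMeasure μ],
      ∀ L ∈ nPlanes d m, ∀ x ∈ msupport μ, ∀ r : ℝ, 0 < r → RegularUpTo μ n C r →
        infDist x (L : Set (Euc d)) ≤ r / 8 →
        ∃ q ∈ L, dist x q ≤ r / 4 ∧ ∀ z ∈ msupport μ, θ * r < dist z q := by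
  have hm : (1 : ℝ) ≤ m := by exact_mod_cast (Nat.succ_le_of_lt (Nat.zero_lt_of_lt hnm))
  obtain ⟨N, hN⟩ := exists_nat_gt (C ^ 2 * (40 * m) ^ n)
  have hbase : (1 : ℝ) ≤ C ^ 2 * (40 * m) ^ n :=
    one_le_mul_of_one_le_of_one_le (one_le_pow₀ hC) (one_le_pow₀ (by linarith))
  have hN1 : (1 : ℝ) ≤ N := hbase.trans hN.le
  have hNm : (1 : ℝ) ≤ N * m := one_le_mul_of_one_le_of_one_le hN1 hm
  set θ : ℝ := 1 / (40 * (N * m)) with hθ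
  have hθ0 : 0 < θ := by positivity
  have hθ1 : θ ≤ 1 / 40 := by
    rw [hθ]; gcongr; linarith
  have hθN : θ * (40 * (N * m)) = 1 := by rw [hθ]; field_simp
  refine ⟨θ, hθ0, hθ1, fun μ _ L hL x hx r hr hreg hxL => ?_⟩
  by_contra! hcon
  obtain ⟨q, hq, hqd⟩ :=
    (AffineSubspace.closed_of_finiteDimensional L).exists_infDist_eq_dist hL.1 x
  obtain ⟨g, hgL, hgq, hgsep⟩ := exists_separated_family hL hq N
    (by positivity : 0 ≤ 5 * (θ * r))
  have hgx : ∀ k, dist x (g k) ≤ r / 4 := by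
    intro k
    have h1 := dist_triangle_right x (g k) q
    have h2 := hgq k
    have h3 : 5 * (θ * r) * N * m = r / 8 := by linear_combination r / 8 * hθN
    linarith
  choose y hys hyd using fun k => hcon (g k) (hgL k) (hgx k)
  have hθr : θ * r ≤ r / 40 := by nlinarith
  have hdisj : Pairwise (Function.onFun Disjoint fun k => closedBall (y k) (θ * r)) := by
    intro k l hkl
    refine closedBall_disjoint_closedBall ?_
    have h1 := hgsep k l hkl
    have h2 := dist_triangle4 (g k) (y k) (y l) (g l)
    rw [dist_comm (g k) (y k)] at h2
    have h3 := hyd k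
    have h4 := hyd l
    have : 0 < θ * r := by positivity
    linarith
  have hsub : (⋃ k, closedBall (y k) (θ * r)) ⊆ closedBall x r := by
    refine iUnion_subset fun k => closedBall_subset_closedBall' ?_
    have h1 := dist_triangle_right (y k) x (g k)
    have h2 := hyd k
    have h3 := hgx k
    linarith
  have hsum : ∑ k, μ.real (closedBall (y k) (θ * r)) ≤ C * r ^ n := by
    rw [← measureReal_iUnion_fintype hdisj (fun _ => measurableSet_closedBall)
      (fun _ => measure_closedBall_lt_top.ne)]
    exact (measureReal_mono hsub measure_closedBall_lt_top.ne).trans (hreg x hx r hr le_rfl).2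
  have hlow : (N : ℝ) ^ m * (θ * r) ^ n ≤ C * ∑ k, μ.real (closedBall (y k) (θ * r)) := by
    rw [Finset.mul_sum]
    have := Finset.sum_le_sum fun k (_ : k ∈ (Finset.univ : Finset (Fin m → Fin N))) =>
      (hreg (y k) (hys k) (θ * r) (by positivity) (by linarith)).1
    simpa using this
  have h1 : (N : ℝ) ^ m * (θ * r) ^ n ≤ C ^ 2 * r ^ n := by
    refine hlow.trans ((mul_le_mul_of_nonneg_left hsum (by linarith)).trans (le_of_eq ?_))
    ring
  have h2 : (N : ℝ) ^ m * θ ^ n ≤ C ^ 2 := by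
    rw [mul_pow, ← mul_assoc] at h1
    exact le_of_mul_le_mul_right h1 (by positivity)
  have h3 : (N : ℝ) ^ m ≤ C ^ 2 * (40 * m) ^ n * N ^ n := by
    have h4 : θ ^ n * ((40 * m) ^ n * (N : ℝ) ^ n) = 1 := by
      rw [← mul_pow, ← mul_pow, show θ * (40 * m * N) = 1 by linarith, one_pow]
    calc (N : ℝ) ^ m = N ^ m * θ ^ n * ((40 * m) ^ n * (N : ℝ) ^ n) := by
          rw [mul_assoc, h4, mul_one]
      _ ≤ C ^ 2 * ((40 * m) ^ n * (N : ℝ) ^ n) := by gcongr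
      _ = _ := by ring
  have h5 : (N : ℝ) * N ^ n ≤ N ^ m := by
    rw [← pow_succ']
    exact pow_le_pow_right₀ hN1 hnm
  have h6 : (N : ℝ) ≤ C ^ 2 * (40 * m) ^ n :=
    le_of_mul_le_mul_right (h5.trans h3) (by positivity)
  linarith

lemma exists_flat_ball_of_halfspace (m n : ℕ) {C : ℝ} (hC : 1 ≤ C)
    {ε : ℝ} (hε : 0 < ε) :
    ∃ η : ℝ, 0 < η ∧ η ≤ 1 ∧ ∃ κ : ℝ, 0 < κ ∧ ∃ ν : ℝ, 0 < ν ∧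
      ∀ (μ : Measure (Euc d)) [IsLocallyFiniteMeasure μ] (φ : ℝ → ENNReal),
      IsDistributionFunction μ φ → ∀ L ∈ nPlanes d m, ∀ y ∈ msupport μ, ∀ e ∈ L.direction,
      ‖e‖ = 1 → ∀ s : ℝ, 0 < s → RegularUpTo μ n C (2 * s) →
      (∀ z ∈ msupport μ, ‖z - y‖ ≤ s → -(η * s) ≤ ⟪z - y, e⟫_ℝ) →
      (∀ z ∈ msupport μ, ‖z - y‖ ≤ s → infDist z (L : Set (Euc d)) ≤ ν * s) →
      ∃ r : ℝ, κ * s ≤ r ∧ r ≤ s ∧ jonesBeta (m - 1) μ y r ≤ ε := by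
  have hC0 : 0 < C := by linarith
  obtain ⟨ε₁, hε₁, hε₁', hε₁ε⟩ : ∃ ε₁ : ℝ, 0 < ε₁ ∧ ε₁ ≤ 1 / 4 ∧ ε₁ ≤ ε / 4 :=
    ⟨min (1 / 4) (ε / 4), by positivity, min_le_left _ _, min_le_right _ _⟩
  set ρ := ε₁ / 2 with hρ
  have hρ0 : 0 < ρ := by positivity
  set γ := ρ ^ (n + 1) / (8 * C) with hγ
  have hγ0 : 0 < γ := by positivity
  obtain ⟨η, hη0, hη1, hηε, hηC⟩ : ∃ η : ℝ, 0 < η ∧ η ≤ 1 ∧ η ≤ ε₁ ∧ η * C ≤ γ :=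
    ⟨min ε₁ (γ / C), by positivity, (min_le_left _ _).trans (by linarith), min_le_left _ _,
      by rw [← le_div_iff₀ hC0]; exact min_le_right _ _⟩
  obtain ⟨κ, hκ0, hκ1, hκε⟩ : ∃ κ : ℝ, 0 < κ ∧ κ ≤ 1 / 2 ∧ 7 * C * 2 ^ n * κ ≤ ε * γ / 2 :=
    ⟨min (1 / 2) (ε * γ / 2 / (7 * C * 2 ^ n)), by positivity, min_le_left _ _, by
      rw [mul_comm, ← le_div_iff₀ (by positivity)]; exact min_le_right _ _⟩
  obtain ⟨ν, hν0, hν1, hνε⟩ : ∃ ν : ℝ, 0 < ν ∧ 3 * ν ≤ ε₁ ∧ ν * (γ + 2 * C) ≤ ε * κ * γ / 2 :=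
    ⟨min (ε₁ / 3) (ε * κ * γ / 2 / (γ + 2 * C)), by positivity,
      by linarith [min_le_left (ε₁ / 3) (ε * κ * γ / 2 / (γ + 2 * C))], by
      rw [← le_div_iff₀ (by positivity)]; exact min_le_right _ _⟩
  refine ⟨η, hη0, hη1, κ, hκ0, ν, hν0, fun μ _ φ hφ L hL y hy e he he1 s hs hreg hhalf hflat => ?_⟩
  have hyL : infDist y (L : Set (Euc d)) ≤ ν * s := hflat y hy (by simpa using hs.le)
  by_cases hcase : ∃ z₀ ∈ msupport μ, ‖z₀ - y‖ ≤ s / 2 ∧ 2 * ρ * s ≤ ⟪z₀ - y, e⟫_ℝ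
  · obtain ⟨z₀, hz₀, hz₀y, hz₀e⟩ := hcase
    set b := localMoment μ y s
    have hD : 0 < s ^ (n + 3) := by positivity
    have hlow : γ * s ^ (n + 3) ≤ ⟪b, e⟫_ℝ := by
      refine le_trans ?_ (le_inner_localMoment he1 hs hη0.le hρ0 (by linarith) hhalf hz₀y hz₀e)
      have h1 := (hreg z₀ hz₀ (ρ * s) (by positivity) (by nlinarith)).1
      have h2 := (hreg y hy s hs (by linarith)).2
      have h3 : 2 * γ * s ^ n ≤ ρ / 4 * μ.real (closedBall z₀ (ρ * s)) := by
        have : 2 * γ * s ^ n = ρ / 4 * ((ρ * s) ^ n / C) := by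
          rw [hγ]; field_simp; ring
        rw [this]
        gcongr
        rwa [div_le_iff₀' hC0]
      have h4 : η * μ.real (closedBall y s) ≤ γ * s ^ n := by
        calc η * μ.real (closedBall y s) ≤ η * (C * s ^ n) := by gcongr
          _ = η * C * s ^ n := by ring
          _ ≤ _ := by gcongr
      calc γ * s ^ (n + 3) = s ^ 3 * (γ * s ^ n) := by ring
        _ ≤ _ := by gcongr; linarith
    have hbn : ‖b‖ ≤ C * s ^ (n + 3) := by
      refine (norm_localMoment_le y hs.le).trans ?_
      calc s ^ 3 * μ.real (closedBall y s) ≤ s ^ 3 * (C * s ^ n) := by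
            gcongr; exact (hreg y hy s hs (by linarith)).2
        _ = _ := by ring
    obtain ⟨L', hL', hdist⟩ := exists_nPlane_pred hL y he he1 (by positivity) hlow
    refine ⟨κ * s, le_rfl, by nlinarith, jonesBeta_le hL' (by positivity) hε.le fun z hz => ?_⟩
    have hzy : ‖z - y‖ ≤ κ * s := by simpa [dist_eq_norm] using hz.2
    have hzs : ‖z - y‖ ≤ s := hzy.trans (by nlinarith)
    have hzL := hflat z hz.1 hzs
    refine (hdist z).trans ?_
    have hin : |⟪b, z - y⟫_ℝ| ≤ 7 * C * 2 ^ n * κ ^ 2 * s * s ^ (n + 3) := by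
      refine (hφ.abs_inner_localMoment_le hz.1 hy hs.le hzs).trans ?_
      calc 7 * s ^ 2 * ‖z - y‖ ^ 2 * μ.real (closedBall y (2 * s))
          ≤ 7 * s ^ 2 * (κ * s) ^ 2 * (C * (2 * s) ^ n) := by
            gcongr; exact (hreg y hy (2 * s) (by positivity) le_rfl).2
        _ = _ := by ring
    have hnum : |⟪b, z - y⟫_ℝ| + ‖b‖ * (infDist z (L : Set (Euc d)) + infDist y (L : Set (Euc d)))
        ≤ (7 * C * 2 ^ n * κ ^ 2 + 2 * C * ν) * s * s ^ (n + 3) := by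
      have : ‖b‖ * (infDist z (L : Set (Euc d)) + infDist y (L : Set (Euc d))) ≤
          C * s ^ (n + 3) * (ν * s + ν * s) := by
        gcongr
        exact add_nonneg infDist_nonneg infDist_nonneg
      linarith
    have hquot : (|⟪b, z - y⟫_ℝ| + ‖b‖ * (infDist z (L : Set (Euc d)) +
        infDist y (L : Set (Euc d)))) / (γ * s ^ (n + 3)) ≤ (ε * κ - ν) * s := by
      rw [div_le_iff₀ (by positivity)]
      refine hnum.trans ?_
      have h1 : 7 * C * 2 ^ n * κ ^ 2 + 2 * C * ν ≤ (ε * κ - ν) * γ := by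
        have := mul_le_mul_of_nonneg_right hκε hκ0.le
        linarith
      have := mul_le_mul_of_nonneg_right h1 (by positivity : 0 ≤ s * s ^ (n + 3))
      linarith
    linarith
  · push Not at hcase
    obtain ⟨L', hL', hdist⟩ := exists_nPlane_pred hL y he he1 one_pos
      (show 1 ≤ ⟪e, e⟫_ℝ by rw [real_inner_self_eq_norm_sq, he1]; norm_num)
    refine ⟨s / 2, by nlinarith, by linarith,
      jonesBeta_le hL' (by positivity) hε.le fun z hz => ?_⟩
    have hzy : ‖z - y‖ ≤ s / 2 := by simpa [dist_eq_norm] using hz.2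
    have h1 := hcase z hz.1 hzy
    have h2 := hhalf z hz.1 (by linarith)
    have hzL := hflat z hz.1 (by linarith)
    have h3 : |⟪e, z - y⟫_ℝ| ≤ ε₁ * s := by
      rw [real_inner_comm, abs_le]
      constructor <;> nlinarith
    have h4 := hdist z
    rw [he1, div_one, one_mul] at h4
    nlinarith

lemma neg_le_inner_of_norm_sub_le {q y y' z : Euc d} {s η l : ℝ} (hs : 0 ≤ s) (hl : 0 < l)
    (hnear : ‖y - q‖ ≤ ‖z - q‖) (hyy : ‖y - y'‖ ≤ s / 2) (hzy : ‖z - y‖ ≤ s)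
    (hsl : s = η * l) (hfn : l ≤ ‖y' - q‖) :
    -(η * s) ≤ ⟪z - y, ‖y' - q‖⁻¹ • (y' - q)⟫_ℝ := by
  have hη : 0 ≤ η * s := mul_nonneg (nonneg_of_mul_nonneg_left (hsl ▸ hs) hl) hs
  have h1 : 0 ≤ ‖z - y‖ ^ 2 + 2 * ⟪z - y, y - q⟫_ℝ := by
    have h2 := pow_le_pow_left₀ (norm_nonneg _) hnear 2
    rw [show z - q = (z - y) + (y - q) by abel, norm_add_sq_real] at h2
    linarith
  have h2 : ⟪z - y, y - q⟫_ℝ = ⟪z - y, y' - q⟫_ℝ + ⟪z - y, y - y'⟫_ℝ := by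
    rw [← inner_add_right]; congr 1; abel
  have h3 : ⟪z - y, y - y'⟫_ℝ ≤ s * (s / 2) := by
    refine (real_inner_le_norm _ _).trans ?_
    gcongr
  have h4 := pow_le_pow_left₀ (norm_nonneg _) hzy 2
  have h5 : s ^ 2 = η * s * l := by nth_rewrite 1 [sq, hsl]; ring
  have h6 := mul_le_mul_of_nonneg_left hfn hη
  rw [inner_smul_right, inv_mul_eq_div, le_div_iff₀ (hl.trans_le hfn)]
  linarith

end Regularity

theorem flat_ball_dimension_reduction {d n p m : ℕ}
    (μ : Measure (Euc d)) [IsLocallyFiniteMeasure μ]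
    (φ : ℝ → ENNReal) (hφ : IsDistributionFunction μ φ)
    (hn : HasDim0 φ n) (hp : HasDimInfty φ p)
    (hm1 : n < m) (hm2 : m ≤ d) (ε : ℝ) (hε : 0 < ε)
    (K : Set (Euc d)) (hK : IsCompact K) (hdiam : 0 < Metric.diam K) :
    ∃ δ : ℝ, 0 < δ ∧ ∃ τ : ℝ, 0 < τ ∧
      ∀ x ∈ msupport μ ∩ K, ∀ rB : ℝ, 0 < rB → rB ≤ Metric.diam K →
        jonesBeta m μ x rB ≤ δ →
        ∃ x' ∈ msupport μ, ∃ r' : ℝ, τ * rB ≤ r' ∧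
          Metric.closedBall x' r' ⊆ Metric.closedBall x rB ∧
          jonesBeta (m - 1) μ x' r' ≤ ε := by
  obtain ⟨C, hC, hreg⟩ := hφ.exists_regularUpTo hn (Metric.diam K)
  obtain ⟨θ, hθ0, hθ1, hhole⟩ := exists_empty_ball_centered_in_plane (d := d) hm1 hC
  obtain ⟨η, hη0, hη1, κ, hκ0, ν, hν0, hflat⟩ :=
    exists_flat_ball_of_halfspace (d := d) m n hC hε
  set σ := θ * η / 2 with hσ
  have hσ0 : 0 < σ := by positivity
  have hσ1 : σ ≤ 1 / 2 := by rw [hσ]; nlinarith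
  obtain ⟨δ, hδ0, hδ8, hδθ, hδσ, hδν⟩ : ∃ δ : ℝ, 0 < δ ∧ δ ≤ 1 / 8 ∧ δ ≤ θ / 2 ∧ δ ≤ σ / 2 ∧
      δ ≤ ν * σ :=
    ⟨min (min (1 / 8) (θ / 2)) (min (σ / 2) (ν * σ)), by positivity,
      (min_le_left _ _).trans (min_le_left _ _), (min_le_left _ _).trans (min_le_right _ _),
      (min_le_right _ _).trans (min_le_left _ _), (min_le_right _ _).trans (min_le_right _ _)⟩
  refine ⟨δ / 2, by positivity, κ * σ, by positivity, fun x hx r hr hrK hβ => ?_⟩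
  obtain ⟨L, hL, hLd⟩ := exists_nPlane_of_jonesBeta_lt hm2 hr (hβ.trans_lt (half_lt_self hδ0))
  have hxL := hLd x ⟨hx.1, mem_closedBall_self hr.le⟩
  obtain ⟨q, hq, hxq, hempty⟩ := hhole μ L hL x hx.1 r hr (hreg.mono hrK) (by nlinarith)
  obtain ⟨y, hy, hyq⟩ := (isClosed_msupport μ).exists_infDist_eq_dist ⟨x, hx.1⟩ q
  have hnear : ∀ z ∈ msupport μ, ‖y - q‖ ≤ ‖z - q‖ := by
    intro z hz
    rw [← dist_eq_norm, ← dist_eq_norm, dist_comm y, dist_comm z, ← hyq]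
    exact infDist_le_dist_of_mem hz
  have hyx : dist y x ≤ r / 2 := by
    have h1 := dist_triangle_right y x q
    have h2 := hnear x hx.1
    rw [← dist_eq_norm, ← dist_eq_norm] at h2
    linarith
  have hyL := hLd y ⟨hy, by rw [mem_closedBall]; linarith⟩
  obtain ⟨y', hy', hyy'⟩ :=
    (AffineSubspace.closed_of_finiteDimensional L).exists_infDist_eq_dist hL.1 y
  have hyy : ‖y - y'‖ ≤ δ * r := by rw [← dist_eq_norm, ← hyy']; exact hyL
  set f := y' - q with hf
  have hfL : f ∈ L.direction := AffineSubspace.vsub_mem_direction hy' hq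
  have hfn : θ * r / 2 ≤ ‖f‖ := by
    have h1 := hempty y hy
    rw [dist_eq_norm] at h1
    have h2 : ‖y - q‖ ≤ ‖y - y'‖ + ‖f‖ := by
      rw [show y - q = (y - y') + f by rw [hf]; abel]; exact norm_add_le _ _
    nlinarith
  have hf0 : 0 < ‖f‖ := lt_of_lt_of_le (by positivity) hfn
  have hball : ∀ z, ‖z - y‖ ≤ σ * r → z ∈ closedBall x r := by
    intro z hz
    rw [← dist_eq_norm] at hz
    rw [mem_closedBall]
    have := dist_triangle z y x
    nlinarith
  have hhalf : ∀ z ∈ msupport μ, ‖z - y‖ ≤ σ * r →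
      -(η * (σ * r)) ≤ ⟪z - y, ‖f‖⁻¹ • f⟫_ℝ := by
    intro z hz hzy
    exact neg_le_inner_of_norm_sub_le (by positivity) (by positivity) (hnear z hz)
      (hyy.trans (by nlinarith)) hzy (by rw [hσ]; ring) hfn
  have hplane : ∀ z ∈ msupport μ, ‖z - y‖ ≤ σ * r → infDist z (L : Set (Euc d)) ≤ ν * (σ * r) :=
    fun z hz hzy => (hLd z ⟨hz, hball z hzy⟩).trans (by nlinarith)
  obtain ⟨r', hr1, hr2, hr3⟩ := hflat μ φ hφ L hL y hy (‖f‖⁻¹ • f)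
    (Submodule.smul_mem _ _ hfL)
    (by rw [norm_smul, norm_inv, norm_norm, inv_mul_cancel₀ hf0.ne']) (σ * r) (by positivity)
    (hreg.mono (by nlinarith)) hhalf hplane
  refine ⟨y, hy, r', by linarith, closedBall_subset_closedBall' ?_, hr3⟩
  nlinarith
end
end
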